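/- For every integer k ≥ 3 there exists n₀ ∈ ℕ such that for all n ≥ n₀, every simple graph G on n vertices with exactly ⌊n²/4⌋ + 1 edges contains at least ⌊n²/4⌋ + 1 − ⌊(n+4)/6⌋·⌊(n+1)/6⌋ edges that occur in C_{2k+1}. -/

import Mathlib

open SimpleGraph

/-- An edge `e` of `G` occurs in `C_m`: `G` contains a cycle of length `m`
whose edge set contains `e`. -/
def occursInC {V : Type*} (G : SimpleGraph V) (m : ℕ) (e : Sym2 V) : Prop :=
  ∃ (u : V) (w : G.Walk u u), w.IsCycle ∧ w.length = m ∧ e ∈ w.edges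

/-- The number of edges of `G` that occur in a cycle of length `m`. -/
noncomputable def countEdgesInC {V : Type*} (G : SimpleGraph V) (m : ℕ) : ℕ :=
  {e | e ∈ G.edgeSet ∧ occursInC G m e}.ncard


/-! ## Degree and edge counting -/

noncomputable def ad {V : Type*} (H : SimpleGraph V) (u v : V) : ℝ :=
  @ite ℝ (H.Adj u v) (Classical.propDecidable _) 1 0

noncomputable def dg {V : Type*} (H : SimpleGraph V) (v : V) (B : Finset V) : ℝ :=
  ∑ b ∈ B, ad H v b

noncomputable def ee {V : Type*} (H : SimpleGraph V) (A B : Finset V) : ℝ :=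
  ∑ a ∈ A, dg H a B

/-- classical filter -/
noncomputable def fs {V : Type*} (B : Finset V) (p : V → Prop) : Finset V :=
  @Finset.filter V p (Classical.decPred p) B

noncomputable def nb {V : Type*} (H : SimpleGraph V) (v : V) (B : Finset V) : Finset V :=
  fs B (H.Adj v)

section basics
variable {V : Type*}

@[simp] lemma mem_fs {B : Finset V} {p : V → Prop} {x : V} : x ∈ fs B p ↔ x ∈ B ∧ p x := by
  simp [fs]

@[simp] lemma mem_nb {H : SimpleGraph V} {v : V} {B : Finset V} {x : V} :
    x ∈ nb H v B ↔ x ∈ B ∧ H.Adj v x := by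
  simp [nb]

lemma fs_sub (B : Finset V) (p : V → Prop) : fs B p ⊆ B := fun _ hx => (mem_fs.1 hx).1

lemma nb_sub (H : SimpleGraph V) (v : V) (B : Finset V) : nb H v B ⊆ B := fs_sub _ _

lemma ad_of {H : SimpleGraph V} {u v : V} (h : H.Adj u v) : ad H u v = 1 := by simp [ad, h]
lemma ad_not {H : SimpleGraph V} {u v : V} (h : ¬ H.Adj u v) : ad H u v = 0 := by simp [ad, h]
lemma ad_nonneg (H : SimpleGraph V) (u v : V) : 0 ≤ ad H u v := by
  unfold ad; split_ifs <;> norm_num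
lemma ad_le_one (H : SimpleGraph V) (u v : V) : ad H u v ≤ 1 := by
  unfold ad; split_ifs <;> norm_num
lemma ad_comm (H : SimpleGraph V) (u v : V) : ad H u v = ad H v u := by
  by_cases h : H.Adj u v
  · rw [ad_of h, ad_of h.symm]
  · rw [ad_not h, ad_not (fun h' => h h'.symm)]
lemma ad_self (H : SimpleGraph V) (u : V) : ad H u u = 0 := by simp [ad]
lemma ad_mono {H G : SimpleGraph V} (h : H ≤ G) (u v : V) : ad H u v ≤ ad G u v := by
  by_cases h1 : H.Adj u v
  · rw [ad_of h1, ad_of (h h1)]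
  · rw [ad_not h1]; exact ad_nonneg _ _ _

lemma sum_ite_fs (B : Finset V) (p : V → Prop) (f : V → ℝ) :
    ∑ b ∈ fs B p, f b = ∑ b ∈ B, @ite ℝ (p b) (Classical.propDecidable _) (f b) 0 := by
  classical
  unfold fs
  rw [Finset.sum_filter]

lemma dg_eq_card (H : SimpleGraph V) (v : V) (B : Finset V) : dg H v B = ((nb H v B).card : ℝ) := by
  have := sum_ite_fs B (H.Adj v) (fun _ => (1:ℝ))
  simp only [Finset.sum_const, nsmul_eq_mul, mul_one] at this
  unfold nb dg ad
  rw [this]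

lemma dg_nonneg (H : SimpleGraph V) (v : V) (B : Finset V) : 0 ≤ dg H v B :=
  Finset.sum_nonneg fun _ _ => ad_nonneg _ _ _

lemma dg_le_card (H : SimpleGraph V) (v : V) (B : Finset V) : dg H v B ≤ B.card := by
  rw [dg_eq_card]; exact_mod_cast Finset.card_le_card (nb_sub _ _ _)

lemma dg_mono (H : SimpleGraph V) (v : V) {A B : Finset V} (h : A ⊆ B) : dg H v A ≤ dg H v B :=
  Finset.sum_le_sum_of_subset_of_nonneg h fun _ _ _ => ad_nonneg _ _ _

lemma dg_mono_graph {H G : SimpleGraph V} (h : H ≤ G) (v : V) (B : Finset V) :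
    dg H v B ≤ dg G v B := Finset.sum_le_sum fun _ _ => ad_mono h _ _

lemma dg_union [DecidableEq V] (H : SimpleGraph V) (v : V) {A B : Finset V} (h : Disjoint A B) :
    dg H v (A ∪ B) = dg H v A + dg H v B := Finset.sum_union h

lemma dg_union_le [DecidableEq V] (H : SimpleGraph V) (v : V) (A B : Finset V) :
    dg H v (A ∪ B) ≤ dg H v A + dg H v B := by
  have h : A ∪ B = A ∪ (B \ A) := by ext x; simp
  rw [h, dg_union H v Finset.disjoint_sdiff]
  have := dg_mono H v (Finset.sdiff_subset (s := B) (t := A))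
  linarith

lemma dg_sdiff [DecidableEq V] (H : SimpleGraph V) (v : V) {A B : Finset V} (h : A ⊆ B) :
    dg H v (B \ A) = dg H v B - dg H v A := by
  have := dg_union H v (Finset.disjoint_sdiff (s := A) (t := B))
  rw [Finset.union_sdiff_of_subset h] at this
  linarith

lemma dg_zero {H : SimpleGraph V} {v : V} {B : Finset V} (h : ∀ b ∈ B, ¬ H.Adj v b) :
    dg H v B = 0 := Finset.sum_eq_zero fun b hb => ad_not (h b hb)

lemma ee_nonneg (H : SimpleGraph V) (A B : Finset V) : 0 ≤ ee H A B :=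
  Finset.sum_nonneg fun _ _ => dg_nonneg _ _ _

lemma ee_comm (H : SimpleGraph V) (A B : Finset V) : ee H A B = ee H B A := by
  unfold ee dg
  rw [Finset.sum_comm]
  simp_rw [ad_comm H]

lemma ee_mono (H : SimpleGraph V) {A B A' B' : Finset V} (h : A ⊆ A') (h' : B ⊆ B') :
    ee H A B ≤ ee H A' B' := by
  unfold ee
  calc _ ≤ ∑ a ∈ A, dg H a B' := Finset.sum_le_sum fun _ _ => dg_mono _ _ h'
    _ ≤ _ := Finset.sum_le_sum_of_subset_of_nonneg h fun _ _ _ => dg_nonneg _ _ _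

lemma ee_mono_graph {H G : SimpleGraph V} (h : H ≤ G) (A B : Finset V) :
    ee H A B ≤ ee G A B := Finset.sum_le_sum fun _ _ => dg_mono_graph h _ _

lemma ee_union_left [DecidableEq V] (H : SimpleGraph V) {A B : Finset V} (C : Finset V)
    (h : Disjoint A B) : ee H (A ∪ B) C = ee H A C + ee H B C := Finset.sum_union h

lemma ee_union_right [DecidableEq V] (H : SimpleGraph V) {A B : Finset V} (C : Finset V)
    (h : Disjoint A B) : ee H C (A ∪ B) = ee H C A + ee H C B := by
  rw [ee_comm, ee_union_left H C h, ee_comm H A, ee_comm H B]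

lemma ee_union_left_le [DecidableEq V] (H : SimpleGraph V) (A B C : Finset V) :
    ee H (A ∪ B) C ≤ ee H A C + ee H B C := by
  rw [ee_comm, ee_comm H A, ee_comm H B]
  unfold ee
  rw [← Finset.sum_add_distrib]
  exact Finset.sum_le_sum fun _ _ => dg_union_le _ _ _ _

lemma ee_union_right_le [DecidableEq V] (H : SimpleGraph V) (A B C : Finset V) :
    ee H C (A ∪ B) ≤ ee H C A + ee H C B := by
  rw [ee_comm, ee_comm H C A, ee_comm H C B]; exact ee_union_left_le _ _ _ _

lemma ee_zero {H : SimpleGraph V} {A B : Finset V} (h : ∀ a ∈ A, ∀ b ∈ B, ¬ H.Adj a b) :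
    ee H A B = 0 := Finset.sum_eq_zero fun a ha => dg_zero (h a ha)

lemma ee_le_mul (H : SimpleGraph V) (A B : Finset V) : ee H A B ≤ A.card * B.card := by
  unfold ee
  calc _ ≤ ∑ a ∈ A, (B.card : ℝ) := Finset.sum_le_sum fun _ _ => dg_le_card _ _ _
    _ = _ := by simp

lemma ee_le_const {H : SimpleGraph V} {A B : Finset V} {c : ℝ} (h : ∀ a ∈ A, dg H a B ≤ c) :
    ee H A B ≤ A.card * c := by
  unfold ee
  calc _ ≤ ∑ a ∈ A, c := Finset.sum_le_sum h
    _ = _ := by simp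

lemma le_ee_const {H : SimpleGraph V} {A B : Finset V} {c : ℝ} (h : ∀ a ∈ A, c ≤ dg H a B) :
    A.card * c ≤ ee H A B := by
  unfold ee
  calc _ = ∑ a ∈ A, c := by simp
    _ ≤ _ := Finset.sum_le_sum h

lemma ee_self_le (H : SimpleGraph V) (A : Finset V) : ee H A A ≤ A.card * (A.card - 1) := by
  classical
  apply ee_le_const
  intro a ha
  have h1 : dg H a A = dg H a (A.erase a) := by
    unfold dg
    rw [← Finset.add_sum_erase A _ ha, ad_self, zero_add]
  have h2 := dg_le_card H a (A.erase a)
  rw [h1]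
  have : ((A.erase a).card : ℝ) = A.card - 1 := by
    rw [Finset.card_erase_of_mem ha, Nat.cast_sub (Finset.card_pos.2 ⟨a, ha⟩)]; simp
  linarith

/-- pick a neighbour avoiding a small set -/
lemma pick_nb {H : SimpleGraph V} {v : V} {B X : Finset V}
    (h : (X.card : ℝ) < dg H v B) : ∃ w ∈ B, H.Adj v w ∧ w ∉ X := by
  rw [dg_eq_card] at h
  have h' : X.card < (nb H v B).card := by exact_mod_cast h
  obtain ⟨w, hw, hx⟩ := Finset.exists_mem_notMem_of_card_lt_card h'
  rw [mem_nb] at hw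
  exact ⟨w, hw.1, hw.2, hx⟩

lemma card_inter_ge [DecidableEq V] {A B C : Finset V} (hA : A ⊆ C) (hB : B ⊆ C) :
    (A.card : ℝ) + B.card - C.card ≤ ((A ∩ B).card : ℝ) := by
  have h1 := Finset.card_union_add_card_inter A B
  have h2 := Finset.card_le_card (Finset.union_subset hA hB)
  have h1' : ((A ∪ B).card : ℝ) + (A ∩ B).card = A.card + B.card := by exact_mod_cast h1
  have h2' : ((A ∪ B).card : ℝ) ≤ C.card := by exact_mod_cast h2
  linarith

/-- pick a common neighbour (possibly in two different graphs) avoiding a small set -/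
lemma pick_common {H G : SimpleGraph V} {v w : V} {B X : Finset V}
    (h : (X.card : ℝ) < dg H v B + dg G w B - B.card) :
    ∃ z ∈ B, H.Adj v z ∧ G.Adj w z ∧ z ∉ X := by
  classical
  rw [dg_eq_card, dg_eq_card] at h
  have h1 := card_inter_ge (nb_sub H v B) (nb_sub G w B)
  have h' : X.card < (nb H v B ∩ nb G w B).card := by
    exact_mod_cast lt_of_lt_of_le h h1
  obtain ⟨z, hz, hx⟩ := Finset.exists_mem_notMem_of_card_lt_card h'
  simp only [Finset.mem_inter, mem_nb] at hz
  exact ⟨z, hz.1.1, hz.1.2, hz.2.2, hx⟩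

end basics

/-! ## Paths with prescribed support -/

def PS {V : Type*} (G : SimpleGraph V) (l : ℕ) (x y : V) (S : Finset V) : Prop :=
  ∃ p : G.Walk x y, p.IsPath ∧ p.length = l ∧ ∀ z, z ∈ p.support ↔ z ∈ S

section paths
variable {V : Type*} {G : SimpleGraph V}

lemma PS.card {l : ℕ} {x y : V} {S : Finset V} (h : PS G l x y S) : S.card = l + 1 := by
  classical
  obtain ⟨p, hp, hl, hS⟩ := h
  have : S = p.support.toFinset := by ext z; simp [hS]
  rw [this, List.toFinset_card_of_nodup hp.support_nodup, Walk.length_support, hl]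

lemma PS.left_mem {l : ℕ} {x y : V} {S : Finset V} (h : PS G l x y S) : x ∈ S := by
  obtain ⟨p, hp, hl, hS⟩ := h
  exact (hS x).1 p.start_mem_support

lemma PS.right_mem {l : ℕ} {x y : V} {S : Finset V} (h : PS G l x y S) : y ∈ S := by
  obtain ⟨p, hp, hl, hS⟩ := h
  exact (hS y).1 p.end_mem_support

lemma PS.symm {l : ℕ} {x y : V} {S : Finset V} (h : PS G l x y S) : PS G l y x S := by
  obtain ⟨p, hp, hl, hS⟩ := h
  exact ⟨p.reverse, hp.reverse, by simpa using hl, by simpa using hS⟩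

lemma PS.nil (x : V) : PS G 0 x x {x} := ⟨Walk.nil, by simp, by simp, by simp⟩

lemma PS.cons [DecidableEq V] {l : ℕ} {x y z : V} {S : Finset V} (hxy : G.Adj x y)
    (h : PS G l y z S) (hx : x ∉ S) : PS G (l + 1) x z (insert x S) := by
  obtain ⟨p, hp, hl, hS⟩ := h
  refine ⟨Walk.cons hxy p, ?_, by simp [hl], by simp [hS]⟩
  rw [Walk.cons_isPath_iff]
  exact ⟨hp, by rwa [hS]⟩

lemma PS.snoc [DecidableEq V] {l : ℕ} {x y z : V} {S : Finset V}
    (h : PS G l x y S) (hyz : G.Adj y z) (hz : z ∉ S) : PS G (l + 1) x z (insert z S) :=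
  (PS.cons hyz.symm h.symm hz).symm

lemma PS.edge [DecidableEq V] {x y : V} (h : G.Adj x y) : PS G 1 x y {x, y} :=
  PS.cons h (PS.nil y) (by simpa using h.ne)

lemma PS.append [DecidableEq V] {l m : ℕ} {x y z : V} {S T : Finset V}
    (h : PS G l x y S) (h' : PS G m y z T) (hd : Disjoint S (T.erase y)) :
    PS G (l + m) x z (S ∪ T) := by
  obtain ⟨p, hp, hl, hS⟩ := h
  obtain ⟨q, hq, hm, hT⟩ := h'
  refine ⟨p.append q, ?_, by simp [hl, hm], fun w => by
    rw [Walk.mem_support_append_iff, hS, hT, Finset.mem_union]⟩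
  rw [Walk.isPath_def, Walk.support_append, List.nodup_append]
  refine ⟨hp.support_nodup, hq.support_nodup.tail, ?_⟩
  intro a ha b hb hab
  subst hab
  have h1 : a ∈ S := (hS a).1 ha
  have h2 : a ∈ T := (hT a).1 (List.mem_of_mem_tail hb)
  have h3 : a ≠ y := by
    rintro rfl
    have := hq.support_nodup
    rw [← Walk.cons_tail_support] at this
    exact (List.nodup_cons.1 this).1 hb
  exact (Finset.disjoint_left.1 hd) h1 (Finset.mem_erase.2 ⟨h3, h2⟩)

/-- join two disjoint paths via an edge -/
lemma PS.join [DecidableEq V] {l m : ℕ} {x y y' z : V} {S T : Finset V}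
    (h : PS G l x y S) (hy : G.Adj y y') (h' : PS G m y' z T) (hd : Disjoint S T) :
    PS G (l + m + 1) x z (S ∪ T) := by
  have h1 : PS G (m + 1) y z (insert y T) :=
    PS.cons hy h' (fun hT => Finset.disjoint_left.1 hd h.right_mem hT)
  have h2 := PS.append h h1 (by
    rw [Finset.disjoint_left] at hd ⊢
    intro a ha hb
    rw [Finset.mem_erase, Finset.mem_insert] at hb
    rcases hb with ⟨h1, h2 | h2⟩
    · exact h1 h2
    · exact hd ha h2)
  have h3 : S ∪ insert y T = S ∪ T := by
    ext a; simp only [Finset.mem_union, Finset.mem_insert]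
    constructor
    · rintro (h | rfl | h)
      · exact Or.inl h
      · exact Or.inl (PS.right_mem ‹_›)
      · exact Or.inr h
    · tauto
  rw [h3] at h2
  exact h2

/-- flexible even paths in a bipartite-like core -/
lemma even_path [DecidableEq V] {I I0 J0 : Finset V} {N : ℕ}
    (hI : I0 ⊆ I)
    (hc : ∀ x ∈ I, ∀ y ∈ I, (N : ℝ) < dg G x J0 + dg G y J0 - J0.card)
    (hJ : ∀ z ∈ J0, (N : ℝ) < dg G z I0) :
    ∀ j : ℕ, ∀ x ∈ I, ∀ y ∈ I, ∀ X : Finset V, x ≠ y → x ∉ X → y ∉ X →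
      X.card + 2 * j + 3 ≤ N → ∃ S, PS G (2 * (j + 1)) x y S ∧ Disjoint S X := by
  intro j
  induction j with
  | zero =>
    intro x hx y hy X hxy hxX hyX hN
    obtain ⟨z, hz, hxz, hyz, hzX⟩ := pick_common (H := G) (G := G) (v := x) (w := y) (B := J0) (X := X)
      (lt_of_le_of_lt (by exact_mod_cast (by omega : X.card ≤ N)) (hc x hx y hy))
    refine ⟨insert x {z, y}, PS.cons hxz (PS.edge hyz.symm) ?_, ?_⟩
    · simp [hxz.ne, hxy]
    · rw [Finset.disjoint_left]; intro a ha
      simp only [Finset.mem_insert, Finset.mem_singleton] at ha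
      rcases ha with rfl | rfl | rfl <;> assumption
  | succ j ih =>
    intro x hx y hy X hxy hxX hyX hN
    have hcX : (insert y X).card ≤ X.card + 1 := Finset.card_insert_le _ _
    obtain ⟨z, hz, hxz, -, hzX⟩ := pick_common (H := G) (G := G) (v := x) (w := x) (B := J0)
      (X := insert y X)
      (lt_of_le_of_lt (by exact_mod_cast (by omega : (insert y X).card ≤ N)) (hc x hx x hx))
    have hcX2 : (insert x (insert y X)).card ≤ X.card + 2 := (Finset.card_insert_le _ _).trans (by omega)
    obtain ⟨x', hx', hzx', hx'X⟩ := pick_nb (H := G) (v := z) (B := I0)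
      (X := insert x (insert y X))
      (lt_of_le_of_lt (by exact_mod_cast (by omega : (insert x (insert y X)).card ≤ N)) (hJ z hz))
    simp only [Finset.mem_insert, not_or] at hzX hx'X
    have hcX3 : (insert x (insert z X)).card ≤ X.card + 2 := by
      have := Finset.card_insert_le x (insert z X)
      have := Finset.card_insert_le z X
      omega
    obtain ⟨S, hS, hd⟩ := ih x' (hI hx') y hy (insert x (insert z X)) hx'X.2.1
      (by simp only [Finset.mem_insert, not_or]; exact ⟨hx'X.1, hzx'.ne', hx'X.2.2⟩)
      (by simp only [Finset.mem_insert, not_or]; exact ⟨hxy.symm, fun h => hzX.1 h.symm, hyX⟩) (by omega)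
    rw [Finset.disjoint_right] at hd
    have h1 : z ∉ S := hd (by simp)
    have h2 : x ∉ S := hd (by simp)
    refine ⟨insert x (insert z S), PS.cons hxz (PS.cons hzx' hS h1) ?_, ?_⟩
    · simp [hxz.ne, h2]
    · rw [Finset.disjoint_right]; intro a ha
      simp only [Finset.mem_insert, not_or]
      refine ⟨?_, ?_, hd (by simp [ha])⟩
      · rintro rfl; exact hxX ha
      · rintro rfl; exact hzX.2 ha

end paths


/-! ## The almost bipartite case -/

section bip
variable {V : Type*}

lemma PS.cast {G : SimpleGraph V} {l l' : ℕ} {x y : V} {S : Finset V} (h : PS G l x y S)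
    (e : l = l') : PS G l' x y S := e ▸ h

/-- one side is independent -/
lemma bip_indep [DecidableEq V] {G F : SimpleGraph V} {k : ℕ} (hk : 3 ≤ k) {n : ℝ}
    (hn : (100 * (4 * k + 20) : ℝ) ≤ n)
    (hF : ∀ u v S, F.Adj u v → PS G (2 * k) u v S → False)
    {X0 Y0 : Finset V}
    (hX : ∀ x ∈ X0, 0.39 * n ≤ dg G x Y0) (hY : ∀ y ∈ Y0, 0.39 * n ≤ dg G y X0)
    (hXc : (X0.card : ℝ) ≤ 0.55 * n) (hYc : (Y0.card : ℝ) ≤ 0.55 * n)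
    {x y : V} (hx : x ∈ X0) (hy : y ∈ Y0) (hxy : F.Adj x y) :
    ∀ v w, 0.2 * n ≤ dg G v Y0 → 0.2 * n ≤ dg G w Y0 → ¬ G.Adj v w := by
  have hN : ((4 * k + 20 : ℕ) : ℝ) ≤ 0.01 * n := by push_cast; linarith
  have hkpos : (0:ℝ) ≤ k := Nat.cast_nonneg _
  have hnpos : 0 < n := by linarith
  -- even paths inside Y0
  have evY := even_path (G := G) (I := Y0) (I0 := Y0) (J0 := X0) (N := 4 * k + 20)
    (Finset.Subset.refl _)
    (fun a ha b hb => by have := hY a ha; have := hY b hb; linarith)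
    (fun z hz => by have := hX z hz; linarith)
  have small : ∀ (X : Finset V) (c : ℝ), X.card ≤ 4 * k + 20 → 0.04 * n ≤ c → (X.card : ℝ) < c := by
    intro X c h1 h2
    have : (X.card : ℝ) ≤ ((4 * k + 20 : ℕ) : ℝ) := by exact_mod_cast h1
    linarith
  have c1 : ∀ a : V, ({a} : Finset V).card ≤ 1 := fun a => by simp
  have c2 : ∀ a b : V, ({a, b} : Finset V).card ≤ 2 := fun a b => Finset.card_le_two
  have c3 : ∀ a b c : V, ({a, b, c} : Finset V).card ≤ 3 := fun a b c => Finset.card_le_three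
  have c4 : ∀ a b c d : V, ({a, b, c, d} : Finset V).card ≤ 4 := fun a b c d => Finset.card_le_four
  -- y is not in X1
  have hyX1 : ∀ v, 0.2 * n ≤ dg G v Y0 → v ≠ y := by
    rintro v hv rfl
    obtain ⟨y', hy', hvy', hy'X⟩ := pick_nb (H := G) (v := v) (B := Y0) (X := {x, v})
      (small _ _ ((c2 _ _).trans (by omega)) (by linarith))
    simp only [Finset.mem_insert, Finset.mem_singleton, not_or] at hy'X
    obtain ⟨y1, hy1, hxy1, hy1X⟩ := pick_nb (H := G) (v := x) (B := Y0) (X := {y', v})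
      (small _ _ ((c2 _ _).trans (by omega)) (by have := hX x hx; linarith))
    simp only [Finset.mem_insert, Finset.mem_singleton, not_or] at hy1X
    obtain ⟨S, hS, hd⟩ := evY (k - 2) y1 hy1 y' hy' {x, v} hy1X.1
      (by simp only [Finset.mem_insert, Finset.mem_singleton, not_or]; exact ⟨hxy1.ne', hy1X.2⟩)
      (by simp only [Finset.mem_insert, Finset.mem_singleton, not_or]; exact hy'X)
      (by have := c2 x v; omega)
    rw [Finset.disjoint_right] at hd
    have hxS : x ∉ S := hd (by simp)
    have hvS : v ∉ S := hd (by simp)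
    have h1 := PS.cons hxy1 hS hxS
    have h2 := h1.snoc hvy'.symm (by simp only [Finset.mem_insert, not_or]; exact ⟨hxy.ne', hvS⟩)
    exact hF _ _ _ hxy (h2.cast (by omega))
  -- edges at x
  have hxX1 : ∀ w, 0.2 * n ≤ dg G w Y0 → ¬ G.Adj x w := by
    intro w hw hxw
    have hwy := hyX1 w hw
    obtain ⟨y2, hy2, hwy2, hy2X⟩ := pick_nb (H := G) (v := w) (B := Y0) (X := {x, y})
      (small _ _ ((c2 _ _).trans (by omega)) (by linarith))
    simp only [Finset.mem_insert, Finset.mem_singleton, not_or] at hy2X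
    obtain ⟨S, hS, hd⟩ := evY (k - 2) y2 hy2 y hy {x, w} hy2X.2
      (by simp only [Finset.mem_insert, Finset.mem_singleton, not_or]; exact ⟨hy2X.1, hwy2.ne'⟩)
      (by simp only [Finset.mem_insert, Finset.mem_singleton, not_or]; exact ⟨hxy.ne', hwy.symm⟩)
      (by have := c2 x w; omega)
    rw [Finset.disjoint_right] at hd
    have hxS : x ∉ S := hd (by simp)
    have hwS : w ∉ S := hd (by simp)
    have h1 := PS.cons hxw (PS.cons hwy2 hS hwS)
      (by simp only [Finset.mem_insert, not_or]; exact ⟨hxw.ne, hxS⟩)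
    exact hF _ _ _ hxy (h1.cast (by omega))
  intro v w hv hw hvw
  by_cases hvx : v = x
  · subst hvx; exact hxX1 w hw hvw
  by_cases hwx : w = x
  · subst hwx; exact hxX1 v hv hvw.symm
  have hvy := hyX1 v hv
  have hwy := hyX1 w hw
  obtain ⟨y1, hy1, hxy1, hvy1, hy1X⟩ := pick_common (H := G) (G := G) (v := x) (w := v) (B := Y0)
    (X := {y, w}) (small _ _ ((c2 _ _).trans (by omega)) (by have := hX x hx; linarith))
  simp only [Finset.mem_insert, Finset.mem_singleton, not_or] at hy1X
  obtain ⟨y2, hy2, hwy2, hy2X⟩ := pick_nb (H := G) (v := w) (B := Y0) (X := {x, y, v, y1})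
    (small _ _ ((c4 _ _ _ _).trans (by omega)) (by linarith))
  simp only [Finset.mem_insert, Finset.mem_singleton, not_or] at hy2X
  obtain ⟨S, hS, hd⟩ := evY (k - 3) y2 hy2 y hy {x, w, v, y1} hy2X.2.1
    (by simp only [Finset.mem_insert, Finset.mem_singleton, not_or]
        exact ⟨hy2X.1, hwy2.ne', hy2X.2.2.1, hy2X.2.2.2⟩)
    (by simp only [Finset.mem_insert, Finset.mem_singleton, not_or]
        exact ⟨hxy.ne', hwy.symm, hvy.symm, fun h => hy1X.1 h.symm⟩)
    (by have := c4 x w v y1; omega)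
  rw [Finset.disjoint_right] at hd
  have hxS : x ∉ S := hd (by simp)
  have hwS : w ∉ S := hd (by simp)
  have hvS : v ∉ S := hd (by simp)
  have hy1S : y1 ∉ S := hd (by simp)
  have h1 := PS.cons hwy2 hS hwS
  have h2 := PS.cons hvw h1 (by simp only [Finset.mem_insert, not_or]; exact ⟨hvw.ne, hvS⟩)
  have h3 := PS.cons hvy1.symm h2
    (by simp only [Finset.mem_insert, not_or]; exact ⟨hvy1.ne', hy1X.2, hy1S⟩)
  have h4 := PS.cons hxy1 h3
    (by simp only [Finset.mem_insert, not_or]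
        exact ⟨hxy1.ne, fun h => hvx h.symm, fun h => hwx h.symm, hxS⟩)
  exact hF _ _ _ hxy (h4.cast (by omega))

/-- vertices of low degree in a dense pair are few -/
lemma few_low {G : SimpleGraph V} {X Y : Finset V} {c d s : ℝ}
    (h : (X.card : ℝ) * Y.card - s ≤ ee G X Y) (hc : c + d ≤ Y.card) :
    ((fs X (fun x => dg G x Y < c)).card : ℝ) * d ≤ s := by
  classical
  set L := fs X (fun x => dg G x Y < c) with hL
  have hLX : L ⊆ X := fs_sub _ _
  have h1 : ee G X Y ≤ L.card * c + ((X \ L).card : ℝ) * Y.card := by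
    rw [← Finset.union_sdiff_of_subset hLX, ee_union_left G Y Finset.disjoint_sdiff]
    have a1 : ee G L Y ≤ L.card * c := ee_le_const fun a ha => by
      rw [hL, mem_fs] at ha; exact ha.2.le
    have a2 := ee_le_mul G (X \ L) Y
    rw [Finset.union_sdiff_of_subset hLX]
    linarith
  have h2 : ((X \ L).card : ℝ) = X.card - L.card := by
    rw [Finset.card_sdiff_of_subset hLX, Nat.cast_sub (Finset.card_le_card hLX)]
  rw [h2] at h1
  have h3 : (0:ℝ) ≤ L.card := Nat.cast_nonneg _
  nlinarith

lemma card_sdiff_real [DecidableEq V] {A B : Finset V} (h : A ⊆ B) :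
    ((B \ A).card : ℝ) = B.card - A.card := by
  rw [Finset.card_sdiff_of_subset h, Nat.cast_sub (Finset.card_le_card h)]

set_option maxHeartbeats 1000000 in
lemma bip_case [Fintype V] [DecidableEq V] {G F : SimpleGraph V} {k : ℕ} (hk : 3 ≤ k) {n : ℝ}
    (hV : (Fintype.card V : ℝ) = n)
    (hn : (100 * (4 * k + 20) : ℝ) ≤ n)
    (hFG : F ≤ G)
    (hF : ∀ u v S, F.Adj u v → PS G (2 * k) u v S → False)
    (hG1 : n ^ 2 / 2 < ee G Finset.univ Finset.univ)
    (hG2 : ee G Finset.univ Finset.univ ≤ n ^ 2 / 2 + 2)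
    (hF1 : n ^ 2 / 20 ≤ ee F Finset.univ Finset.univ)
    {X Y : Finset V} (hXY : Disjoint X Y)
    (hd : n ^ 2 / 4 - n ^ 2 / 4000 ≤ ee G X Y) : False := by
  have hkpos : (3:ℝ) ≤ k := by exact_mod_cast hk
  have hnpos : 3000 < n := by linarith
  have hxy : (X.card : ℝ) + Y.card ≤ n := by
    rw [← hV]
    have := Finset.card_le_univ (X ∪ Y)
    rw [Finset.card_union_of_disjoint hXY] at this
    exact_mod_cast this
  have hprod := ee_le_mul G X Y
  set x : ℝ := (X.card : ℝ) with hx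
  set y : ℝ := (Y.card : ℝ) with hy
  have hx0 : 0 ≤ x := Nat.cast_nonneg _
  have hy0 : 0 ≤ y := Nat.cast_nonneg _
  have hdiff : (x - y) ^ 2 ≤ n ^ 2 / 1000 := by nlinarith
  have hdiff1 : |x - y| ≤ 0.04 * n := by
    apply abs_le_of_sq_le_sq _ (by linarith)
    nlinarith
  rw [abs_le] at hdiff1
  have hsum : 0.999 * n ≤ x + y := by nlinarith
  have hxl : 0.47 * n ≤ x := by linarith [hdiff1.1]
  have hyl : 0.47 * n ≤ y := by linarith [hdiff1.2]
  have hxu : x ≤ 0.53 * n := by linarith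
  have hyu : y ≤ 0.53 * n := by linarith
  have hxyle : x * y ≤ n ^ 2 / 4 := by nlinarith [sq_nonneg (x - y)]
  set LX := fs X (fun a => dg G a Y < 0.4 * n) with hLX
  set LY := fs Y (fun a => dg G a X < 0.4 * n) with hLY
  have hLXc : (LX.card : ℝ) ≤ 0.005 * n := by
    have := few_low (G := G) (X := X) (Y := Y) (c := 0.4 * n) (d := 0.07 * n) (s := n ^ 2 / 4000)
      (by linarith) (by linarith)
    rw [← hLX] at this
    by_contra hcon
    push Not at hcon
    nlinarith
  have hLYc : (LY.card : ℝ) ≤ 0.005 * n := by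
    have := few_low (G := G) (X := Y) (Y := X) (c := 0.4 * n) (d := 0.07 * n) (s := n ^ 2 / 4000)
      (by rw [ee_comm]; linarith) (by linarith)
    rw [← hLY] at this
    by_contra hcon
    push Not at hcon
    nlinarith
  have hLXs : LX ⊆ X := fs_sub _ _
  have hLYs : LY ⊆ Y := fs_sub _ _
  set X0 := X \ LX with hX0
  set Y0 := Y \ LY with hY0
  have hX0X : X0 ⊆ X := Finset.sdiff_subset
  have hY0Y : Y0 ⊆ Y := Finset.sdiff_subset
  have cX0 : (X0.card : ℝ) = x - LX.card := card_sdiff_real hLXs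
  have cY0 : (Y0.card : ℝ) = y - LY.card := card_sdiff_real hLYs
  have hlx0 : (0:ℝ) ≤ LX.card := Nat.cast_nonneg _
  have hly0 : (0:ℝ) ≤ LY.card := Nat.cast_nonneg _
  have hX : ∀ a ∈ X0, 0.39 * n ≤ dg G a Y0 := by
    intro a ha
    have h1 : 0.4 * n ≤ dg G a Y := by
      rw [hX0, Finset.mem_sdiff, hLX, mem_fs] at ha
      by_contra h; push Not at h; exact ha.2 ⟨ha.1, h⟩
    have h2 := dg_sdiff G a hLYs
    have h3 := dg_le_card G a LY
    rw [← hY0] at h2; linarith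
  have hY : ∀ a ∈ Y0, 0.39 * n ≤ dg G a X0 := by
    intro a ha
    have h1 : 0.4 * n ≤ dg G a X := by
      rw [hY0, Finset.mem_sdiff, hLY, mem_fs] at ha
      by_contra h; push Not at h; exact ha.2 ⟨ha.1, h⟩
    have h2 := dg_sdiff G a hLXs
    have h3 := dg_le_card G a LX
    rw [← hX0] at h2; linarith
  have hdis0 : Disjoint X0 Y0 := Finset.disjoint_of_subset_left hX0X
    (Finset.disjoint_of_subset_right hY0Y hXY)
  set U := X0 ∪ Y0 with hU
  have hUc : 0.98 * n ≤ (U.card : ℝ) := by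
    rw [hU, Finset.card_union_of_disjoint hdis0]; push_cast; linarith
  have hUcc : ((Finset.univ \ U).card : ℝ) ≤ 0.02 * n := by
    rw [card_sdiff_real (Finset.subset_univ _), Finset.card_univ]; linarith
  -- an F edge
  have hex : ∃ a ∈ X0, ∃ b ∈ Y0, F.Adj a b := by
    by_contra hno
    push Not at hno
    have e0 : ee F X0 Y0 = 0 := ee_zero hno
    have s1 : n ^ 2 / 4 - 0.01 * n ^ 2 ≤ ee G X0 Y0 := by
      have a1 : ee G X Y ≤ ee G X0 Y0 + ee G LX Y + ee G X LY := by
        have t1 : X = LX ∪ X0 := (Finset.union_sdiff_of_subset hLXs).symm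
        have t2 : Y = LY ∪ Y0 := (Finset.union_sdiff_of_subset hLYs).symm
        have b1 : ee G X Y ≤ ee G LX Y + ee G X0 Y := by
          conv_lhs => rw [t1]
          exact ee_union_left_le _ _ _ _
        have b2 : ee G X0 Y ≤ ee G X0 LY + ee G X0 Y0 := by
          conv_lhs => rw [t2]
          exact ee_union_right_le _ _ _ _
        have b3 : ee G X0 LY ≤ ee G X LY := ee_mono G hX0X (Finset.Subset.refl _)
        linarith
      have a2 := ee_le_mul G LX Y
      have a3 := ee_le_mul G X LY
      have a4 : (LX.card : ℝ) * y ≤ 0.005 * n * (0.53 * n) := by gcongr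
      have a5 : x * (LY.card : ℝ) ≤ 0.53 * n * (0.005 * n) := by gcongr
      linarith
    -- F edges outside
    have key : ∀ H : SimpleGraph V, ee H Finset.univ Finset.univ = ee H X0 Y0 + ee H Y0 X0
        + (ee H X0 (Finset.univ \ Y0) + ee H Y0 (Finset.univ \ X0)
          + ee H (Finset.univ \ U) Finset.univ) := by
      intro H
      have b1 : ee H Finset.univ Finset.univ = ee H U Finset.univ
          + ee H (Finset.univ \ U) Finset.univ := by
        rw [← ee_union_left H _ Finset.disjoint_sdiff, Finset.union_sdiff_of_subset (Finset.subset_univ _)]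
      have b2 : ee H U Finset.univ = ee H X0 Finset.univ + ee H Y0 Finset.univ :=
        ee_union_left H _ hdis0
      have b3 : ee H X0 Finset.univ = ee H X0 Y0 + ee H X0 (Finset.univ \ Y0) := by
        rw [← ee_union_right H _ Finset.disjoint_sdiff, Finset.union_sdiff_of_subset (Finset.subset_univ _)]
      have b4 : ee H Y0 Finset.univ = ee H Y0 X0 + ee H Y0 (Finset.univ \ X0) := by
        rw [← ee_union_right H _ Finset.disjoint_sdiff, Finset.union_sdiff_of_subset (Finset.subset_univ _)]
      linarith
    have kG := key G
    have kF := key F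
    rw [ee_comm F Y0 X0, e0] at kF
    rw [ee_comm G Y0 X0] at kG
    have m1 := ee_mono_graph hFG X0 (Finset.univ \ Y0)
    have m2 := ee_mono_graph hFG Y0 (Finset.univ \ X0)
    have m3 := ee_mono_graph hFG (Finset.univ \ U) Finset.univ
    have hn2 : 3000 * 3000 < n ^ 2 := by rw [sq]; gcongr
    linarith
  obtain ⟨a, ha, b, hb, hab⟩ := hex
  have iX := bip_indep hk hn hF hX hY (by linarith) (by linarith) ha hb hab
  have iY := bip_indep hk hn hF hY hX (by linarith) (by linarith) hb ha hab.symm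
  set X1 := fs Finset.univ (fun v => 0.2 * n ≤ dg G v Y0) with hX1
  set Y1 := fs Finset.univ (fun v => 0.2 * n ≤ dg G v X0) with hY1
  have hX01 : X0 ⊆ X1 := fun v hv => by
    rw [hX1, mem_fs]; exact ⟨Finset.mem_univ _, by have := hX v hv; linarith⟩
  have hY01 : Y0 ⊆ Y1 := fun v hv => by
    rw [hY1, mem_fs]; exact ⟨Finset.mem_univ _, by have := hY v hv; linarith⟩
  have hd1 : Disjoint X1 Y1 := by
    rw [Finset.disjoint_left]
    intro v hv hv'
    rw [hX1, mem_fs] at hv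
    rw [hY1, mem_fs] at hv'
    obtain ⟨w, hw, hvw, -⟩ := pick_nb (H := G) (v := v) (B := X0) (X := ∅)
      (by simp; linarith [hv'.2])
    exact iX v w hv.2 (by have := hX w hw; linarith) hvw
  set L := Finset.univ \ (X1 ∪ Y1) with hL
  have hLs : L ⊆ Finset.univ \ U := by
    apply Finset.sdiff_subset_sdiff (Finset.Subset.refl _)
    exact Finset.union_subset_union hX01 hY01
  have hLc : (L.card : ℝ) ≤ 0.02 * n := by
    have : (L.card : ℝ) ≤ (Finset.univ \ U).card := by exact_mod_cast Finset.card_le_card hLs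
    linarith
  have hLdeg : ∀ v ∈ L, dg G v Finset.univ ≤ 0.42 * n := by
    intro v hv
    have h1 : dg G v Finset.univ ≤ dg G v U + dg G v (Finset.univ \ U) := by
      rw [← dg_union G v Finset.disjoint_sdiff, Finset.union_sdiff_of_subset (Finset.subset_univ _)]
    have h2 := dg_union_le G v X0 Y0
    have h3 := dg_le_card G v (Finset.univ \ U)
    rw [hL, Finset.mem_sdiff, Finset.mem_union, hX1, hY1, mem_fs, mem_fs, not_or] at hv
    have h4 : dg G v Y0 < 0.2 * n := by
      by_contra h; push Not at h; exact hv.2.1 ⟨Finset.mem_univ _, h⟩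
    have h5 : dg G v X0 < 0.2 * n := by
      by_contra h; push Not at h; exact hv.2.2 ⟨Finset.mem_univ _, h⟩
    linarith
  have hLe : ee G L Finset.univ ≤ L.card * (0.42 * n) := ee_le_const hLdeg
  have hX1c : (X1.card : ℝ) + Y1.card + L.card = n := by
    rw [hL, card_sdiff_real (Finset.subset_univ _), Finset.card_union_of_disjoint hd1, Finset.card_univ, hV]
    push_cast; ring
  have tot : ee G Finset.univ Finset.univ ≤ 2 * ee G X1 Y1 + 2 * ee G L Finset.univ := by
    have b1 : ee G Finset.univ Finset.univ = ee G (X1 ∪ Y1) Finset.univ + ee G L Finset.univ := by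
      rw [← ee_union_left G _ Finset.disjoint_sdiff, Finset.union_sdiff_of_subset (Finset.subset_univ _)]
    have b2 : ee G (X1 ∪ Y1) Finset.univ = ee G (X1 ∪ Y1) (X1 ∪ Y1) + ee G (X1 ∪ Y1) L := by
      rw [← ee_union_right G _ Finset.disjoint_sdiff, Finset.union_sdiff_of_subset (Finset.subset_univ _)]
    have b3 : ee G (X1 ∪ Y1) L ≤ ee G L Finset.univ := by
      rw [ee_comm]; exact ee_mono G (Finset.Subset.refl _) (Finset.subset_univ _)
    have b4 : ee G (X1 ∪ Y1) (X1 ∪ Y1) = ee G X1 X1 + ee G X1 Y1 + (ee G Y1 X1 + ee G Y1 Y1) := by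
      rw [ee_union_left G _ hd1, ee_union_right G _ hd1, ee_union_right G _ hd1]
    have b5 : ee G X1 X1 = 0 := ee_zero fun v hv w hw => by
      rw [hX1, mem_fs] at hv hw; exact iX v w hv.2 hw.2
    have b6 : ee G Y1 Y1 = 0 := ee_zero fun v hv w hw => by
      rw [hY1, mem_fs] at hv hw; exact iY v w hv.2 hw.2
    rw [ee_comm G Y1 X1] at b4
    linarith
  have hp := ee_le_mul G X1 Y1
  have hl0 : (0:ℝ) ≤ L.card := Nat.cast_nonneg _
  set l : ℝ := (L.card : ℝ)
  have hsq := sq_nonneg ((X1.card : ℝ) - Y1.card)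
  have : 4 * ((X1.card : ℝ) * Y1.card) ≤ (n - l) ^ 2 := by
    have : n - l = (X1.card : ℝ) + Y1.card := by linarith
    rw [this]; clear_value l; linarith [sq_nonneg ((X1.card : ℝ) - Y1.card), (by ring : ((X1.card : ℝ) + Y1.card)^2 = ((X1.card : ℝ) - Y1.card)^2 + 4 * ((X1.card : ℝ) * Y1.card))]
  have hll : l * l ≤ l * (0.02 * n) := by gcongr
  have hln : 0 ≤ l * n := by positivity
  have hexp : (n - l) ^ 2 = n ^ 2 - 2 * (l * n) + l * l := by ring
  clear_value l
  linarith

end bip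


/-! ## The extremal configuration: path facts -/

structure Conf {V : Type*} [Fintype V] [DecidableEq V] (G F : SimpleGraph V) (k : ℕ) (n : ℝ)
    (T0 A0 C0 : Finset V) : Prop where
  hk : 3 ≤ k
  hV : (Fintype.card V : ℝ) = n
  hn : (1000 * (4 * k + 40) : ℝ) ≤ n
  hFG : F ≤ G
  hF : ∀ u v S, F.Adj u v → PS G (2 * k) u v S → False
  dTA : Disjoint T0 A0
  dTC : Disjoint T0 C0
  dAC : Disjoint A0 C0
  cT : (T0.card : ℝ) ≤ (2 / 3 + 0.001) * n
  dT : ∀ v ∈ T0, (2 / 3 - 0.001) * n ≤ dg G v T0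
  cA : (A0.card : ℝ) ≤ (1 / 6 + 0.001) * n
  cC : (C0.card : ℝ) ≤ (1 / 6 + 0.001) * n
  dA : ∀ v ∈ A0, (1 / 6 - 0.001) * n ≤ dg F v C0
  dC : ∀ v ∈ C0, (1 / 6 - 0.001) * n ≤ dg F v A0
  tA : ∀ v ∈ A0, dg G v T0 < 0.003 * n
  tC : ∀ v ∈ C0, dg G v T0 < 0.003 * n
  rest : n ≤ T0.card + A0.card + C0.card + 0.001 * n

/-- vertices attached to the clique-like part -/
noncomputable def sT {V : Type*} [Fintype V] (G : SimpleGraph V) (n : ℝ) (T0 : Finset V) : Finset V :=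
  fs Finset.univ (fun v => 0.4 * n ≤ dg G v T0)
noncomputable def sTT {V : Type*} [Fintype V] (G : SimpleGraph V) (n : ℝ) (T0 : Finset V) : Finset V :=
  fs Finset.univ (fun v => 0.003 * n ≤ dg G v T0)
noncomputable def sA {V : Type*} [Fintype V] (G : SimpleGraph V) (n : ℝ) (C0 : Finset V) : Finset V :=
  fs Finset.univ (fun v => (1 / 6 - 0.008) * n ≤ dg G v C0)

section conf
set_option linter.unusedSectionVars false
variable {V : Type*} [Fintype V] [DecidableEq V] {G F : SimpleGraph V} {k : ℕ} {n : ℝ}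
  {T0 A0 C0 : Finset V}

lemma mem_sT {v : V} : v ∈ sT G n T0 ↔ 0.4 * n ≤ dg G v T0 := by simp [sT]
lemma mem_sTT {v : V} : v ∈ sTT G n T0 ↔ 0.003 * n ≤ dg G v T0 := by simp [sTT]
lemma mem_sA {v : V} : v ∈ sA G n C0 ↔ (1 / 6 - 0.008) * n ≤ dg G v C0 := by simp [sA]

namespace Conf

lemma swap (c : Conf G F k n T0 A0 C0) : Conf G F k n T0 C0 A0 :=
  ⟨c.hk, c.hV, c.hn, c.hFG, c.hF, c.dTC, c.dTA, c.dAC.symm, c.cT, c.dT, c.cC, c.cA, c.dC, c.dA,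
    c.tC, c.tA, by have := c.rest; linarith⟩

lemma hN (c : Conf G F k n T0 A0 C0) : ((4 * k + 40 : ℕ) : ℝ) ≤ 0.001 * n := by
  have := c.hn; push_cast; linarith

lemma npos (c : Conf G F k n T0 A0 C0) : 50000 ≤ n := by
  have := c.hn
  have h : (3:ℝ) ≤ k := by exact_mod_cast c.hk
  linarith

lemma small (c : Conf G F k n T0 A0 C0) {X : Finset V} {r : ℝ} (h1 : X.card ≤ 4 * k + 40)
    (h2 : 0.001 * n < r) : (X.card : ℝ) < r := by
  have : (X.card : ℝ) ≤ ((4 * k + 40 : ℕ) : ℝ) := by exact_mod_cast h1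
  have := c.hN
  linarith

lemma T0_sub (c : Conf G F k n T0 A0 C0) : T0 ⊆ sT G n T0 := fun v hv => by
  rw [mem_sT]; have := c.dT v hv; have := c.npos; linarith

lemma T_sub (c : Conf G F k n T0 A0 C0) : sT G n T0 ⊆ sTT G n T0 := fun v hv => by
  rw [mem_sT] at hv; rw [mem_sTT]; have := c.npos; linarith

lemma dAG (c : Conf G F k n T0 A0 C0) {v : V} (hv : v ∈ A0) : (1 / 6 - 0.001) * n ≤ dg G v C0 :=
  (c.dA v hv).trans (dg_mono_graph c.hFG _ _)

lemma A0_sub (c : Conf G F k n T0 A0 C0) : A0 ⊆ sA G n C0 := fun v hv => by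
  rw [mem_sA]; have := c.dAG hv; have := c.npos; linarith

lemma A0_not_TT (c : Conf G F k n T0 A0 C0) {v : V} (hv : v ∈ A0) : v ∉ sTT G n T0 := by
  rw [mem_sTT]; have := c.tA v hv; linarith

lemma T_path (c : Conf G F k n T0 A0 C0) {p : ℕ} (hp : 2 ≤ p) {x y : V} (hx : x ∈ sT G n T0)
    (hy : y ∈ sT G n T0) {X : Finset V} (hxy : x ≠ y) (hxX : x ∉ X) (hyX : y ∉ X)
    (hc : X.card + p + 5 ≤ 4 * k + 40) : ∃ S, PS G p x y S ∧ Disjoint S X := by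
  have hN := c.hN
  have hpos := c.npos
  have ev := even_path (G := G) (I := sT G n T0) (I0 := T0) (J0 := T0) (N := 4 * k + 40)
    c.T0_sub
    (fun a ha b hb => by
      rw [mem_sT] at ha hb; have := c.cT; linarith)
    (fun z hz => by have := c.dT z hz; linarith)
  rcases Nat.even_or_odd' p with ⟨j, rfl | rfl⟩
  · obtain ⟨S, hS, hd⟩ := ev (j - 1) x hx y hy X hxy hxX hyX (by omega)
    exact ⟨S, hS.cast (by omega), hd⟩
  · obtain ⟨z, hz, hxz, hzX⟩ := pick_nb (H := G) (v := x) (B := T0) (X := insert y X)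
      (c.small ((Finset.card_insert_le _ _).trans (by omega)) (by rw [mem_sT] at hx; linarith))
    simp only [Finset.mem_insert, not_or] at hzX
    have hci := Finset.card_insert_le x X
    obtain ⟨S, hS, hd⟩ := ev (j - 1) z (c.T0_sub hz) y hy (insert x X) hzX.1
      (by simp only [Finset.mem_insert, not_or]; exact ⟨hxz.ne', hzX.2⟩)
      (by simp only [Finset.mem_insert, not_or]; exact ⟨hxy.symm, hyX⟩) (by omega)
    rw [Finset.disjoint_right] at hd
    refine ⟨insert x S, (PS.cons hxz hS (hd (by simp))).cast (by omega), ?_⟩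
    rw [Finset.disjoint_right]; intro a ha
    simp only [Finset.mem_insert, not_or]
    exact ⟨fun h => hxX (h ▸ ha), hd (by simp [ha])⟩

lemma TT_path (c : Conf G F k n T0 A0 C0) {p : ℕ} (hp : 3 ≤ p) {x y : V} (hx : x ∈ sTT G n T0)
    (hy : y ∈ sTT G n T0) {X : Finset V} (hxy : x ≠ y) (hxX : x ∉ X) (hyX : y ∉ X)
    (hc : X.card + p + 7 ≤ 4 * k + 40) : ∃ S, PS G p x y S ∧ Disjoint S X := by
  have hpos := c.npos
  rw [mem_sTT] at hx hy
  have hc1 := Finset.card_insert_le y X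
  obtain ⟨z, hz, hxz, hzX⟩ := pick_nb (H := G) (v := x) (B := T0) (X := insert y X)
      (c.small (by omega) (by linarith))
  have hc2 := Finset.card_insert_le x X
  have hc3 := Finset.card_insert_le z (insert x X)
  obtain ⟨z', hz', hyz', hzz', hz'X⟩ := pick_common (H := G) (G := G) (v := y) (w := z) (B := T0)
    (X := insert z (insert x X))
    (by
      have h1 := c.dT z hz
      have h2 := c.cT
      have h3 : ((insert z (insert x X)).card : ℝ) ≤ ((4 * k + 40 : ℕ) : ℝ) := by
        exact_mod_cast (by omega)
      have h4 := c.hn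
      have h5 : X.card + 10 ≤ 4 * k + 40 := by omega
      have h6 : ((insert z (insert x X)).card : ℝ) ≤ ((4 * k + 40 - 8 : ℕ) : ℝ) := by
        exact_mod_cast (by omega)
      rw [Nat.cast_sub (by omega)] at h6
      have := c.hN
      have e8 : ((8 : ℕ) : ℝ) = 8 := by norm_num
      linarith)
  simp only [Finset.mem_insert, not_or] at hzX hz'X
  have mid : ∃ S, PS G (p - 2) z z' S ∧ Disjoint S (insert x (insert y X)) := by
    by_cases h3 : p = 3
    · subst h3
      refine ⟨_, PS.edge hzz', ?_⟩
      rw [Finset.disjoint_right]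
      intro a ha
      simp only [Finset.mem_insert, Finset.mem_singleton, not_or] at ha ⊢
      rcases ha with rfl | rfl | ha
      · exact ⟨hxz.ne, fun h => hz'X.2.1 h.symm⟩
      · exact ⟨fun h => hzX.1 h.symm, hyz'.ne⟩
      · exact ⟨fun h => hzX.2 (h ▸ ha), fun h => hz'X.2.2 (h ▸ ha)⟩
    · have hc4 := Finset.card_insert_le x (insert y X)
      exact c.T_path (by omega) (c.T0_sub hz) (c.T0_sub hz') hzz'.ne
        (by simp only [Finset.mem_insert, not_or]; exact ⟨hxz.ne', hzX.1, hzX.2⟩)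
        (by simp only [Finset.mem_insert, not_or]; exact ⟨hz'X.2.1, hyz'.ne', hz'X.2.2⟩)
        (by omega)
  obtain ⟨S, hS, hd⟩ := mid
  rw [Finset.disjoint_right] at hd
  have hxS : x ∉ S := hd (by simp)
  have hyS : y ∉ S := hd (by simp)
  refine ⟨_, ((PS.cons hxz hS hxS).snoc hyz'.symm (by
    simp only [Finset.mem_insert, not_or]; exact ⟨hxy.symm, hyS⟩)).cast (by omega), ?_⟩
  rw [Finset.disjoint_right]; intro a ha
  simp only [Finset.mem_insert, not_or]
  exact ⟨fun h => hyX (h ▸ ha), fun h => hxX (h ▸ ha), hd (by simp [ha])⟩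

lemma A_path (c : Conf G F k n T0 A0 C0) (j : ℕ) {x y : V} (hx : x ∈ sA G n C0)
    (hy : y ∈ sA G n C0) {X : Finset V} (hxy : x ≠ y) (hxX : x ∉ X) (hyX : y ∉ X)
    (hc : X.card + 2 * j + 3 ≤ 4 * k + 40) : ∃ S, PS G (2 * (j + 1)) x y S ∧ Disjoint S X := by
  have hN := c.hN
  have hpos := c.npos
  exact even_path (G := G) (I := sA G n C0) (I0 := A0) (J0 := C0) (N := 4 * k + 40)
    c.A0_sub
    (fun a ha b hb => by
      rw [mem_sA] at ha hb; have := c.cC; linarith)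
    (fun z hz => by have := c.swap.dAG hz; linarith) j x hx y hy X hxy hxX hyX hc

lemma closeAA (c : Conf G F k n T0 A0 C0) {a a' : V} {r j : ℕ} {S : Finset V}
    (ha : a ∈ sA G n C0) (ha' : a' ∈ sA G n C0) (hS : PS G r a' a S)
    (hr : r + 2 * (j + 2) = 2 * k + 1) : False := by
  have hpos := c.npos
  have hSc := hS.card
  obtain ⟨c1, hc1, hac1, hc1S⟩ := pick_nb (H := G) (v := a) (B := C0) (X := S)
    (c.small (by omega) (by rw [mem_sA] at ha; linarith))
  have hi1 := Finset.card_insert_le c1 S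
  obtain ⟨a1, ha1, hca1, ha1S⟩ := pick_nb (H := F) (v := c1) (B := A0) (X := insert c1 S)
    (c.small (by omega) (by have := c.dC c1 hc1; linarith))
  simp only [Finset.mem_insert, not_or] at ha1S
  have hi2 := Finset.card_insert_le c1 (S.erase a')
  have hi3 := Finset.card_erase_le (s := S) (a := a')
  have ha'S : a' ∈ S := hS.left_mem
  obtain ⟨S1, hS1, hd⟩ := c.A_path j (c.A0_sub ha1) ha' (X := insert c1 (S.erase a'))
    (fun h => ha1S.2 (h ▸ ha'S))
    (by simp only [Finset.mem_insert, Finset.mem_erase, not_or, not_and]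
        exact ⟨ha1S.1, fun _ => ha1S.2⟩)
    (by simp only [Finset.mem_insert, Finset.mem_erase, not_or, not_and]
        exact ⟨fun h => hc1S (h ▸ ha'S), fun h => absurd rfl h⟩)
    (by omega)
  have hd2 : Disjoint S1 (S.erase a') :=
    Finset.disjoint_of_subset_right (Finset.subset_insert _ _) hd
  rw [Finset.disjoint_right] at hd
  have h1 := PS.append hS1 hS hd2
  have h2 := h1.snoc hac1 (by
    simp only [Finset.mem_union, not_or]; exact ⟨hd (by simp), hc1S⟩)
  exact c.hF _ _ _ hca1.symm (h2.cast (by omega))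

lemma closeAC (c : Conf G F k n T0 A0 C0) {a b : V} {r j : ℕ} {S : Finset V}
    (ha : a ∈ sA G n C0) (hb : b ∈ sA G n A0) (hS : PS G r b a S)
    (hr : r + 2 * j + 3 = 2 * k + 1) : False := by
  have hpos := c.npos
  have hSc := hS.card
  rw [mem_sA] at hb
  by_cases hj : j = 0
  · subst hj
    obtain ⟨c1, hc1, hac1, hc1S⟩ := pick_nb (H := G) (v := a) (B := C0) (X := S)
      (c.small (by omega) (by rw [mem_sA] at ha; linarith))
    have hi1 := Finset.card_insert_le c1 S
    obtain ⟨a1, ha1, hca1, hba1, ha1S⟩ := pick_common (H := F) (G := G) (v := c1) (w := b)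
      (B := A0) (X := insert c1 S)
      (c.small (by omega) (by have := c.dC c1 hc1; have := c.cA; linarith))
    simp only [Finset.mem_insert, not_or] at ha1S
    have h1 := PS.cons hba1.symm hS ha1S.2
    have h2 := h1.snoc hac1 (by
      simp only [Finset.mem_insert, not_or]; exact ⟨fun h => ha1S.1 h.symm, hc1S⟩)
    exact c.hF _ _ _ hca1.symm (h2.cast (by omega))
  · obtain ⟨a1, ha1, hba1, ha1S⟩ := pick_nb (H := G) (v := b) (B := A0) (X := S)
      (c.small (by omega) (by linarith))
    exact c.closeAA (j := j - 1) ha (c.A0_sub ha1) (PS.cons hba1.symm hS ha1S) (by omega)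

lemma A_indep (c : Conf G F k n T0 A0 C0) {a a' : V} (ha : a ∈ sA G n C0) (ha' : a' ∈ sA G n C0) :
    ¬ G.Adj a a' := fun h => by
  have := c.hk
  exact c.closeAA (j := k - 2) ha ha' (PS.edge h.symm) (by omega)

lemma no_both' (c : Conf G F k n T0 A0 C0) {v a b : V} (ha : a ∈ sA G n C0) (hb : b ∈ sA G n A0)
    (hab : a ≠ b) (h1 : G.Adj v a) (h2 : G.Adj v b) : False := by
  have := c.hk
  exact c.closeAC (j := k - 2) ha hb (PS.cons h2.symm (PS.edge h1)
    (by simp only [Finset.mem_insert, Finset.mem_singleton, not_or]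
        exact ⟨h2.ne', hab.symm⟩)) (by omega)

lemma AC_disj (c : Conf G F k n T0 A0 C0) : Disjoint (sA G n C0) (sA G n A0) := by
  rw [Finset.disjoint_left]
  intro v h1 h2
  have hpos := c.npos
  rw [mem_sA] at h1 h2
  obtain ⟨c1, hc1, hvc, -⟩ := pick_nb (H := G) (v := v) (B := C0) (X := ∅) (by simp; linarith)
  obtain ⟨a1, ha1, hva, -⟩ := pick_nb (H := G) (v := v) (B := A0) (X := ∅) (by simp; linarith)
  exact c.no_both' (c.A0_sub ha1) (c.swap.A0_sub hc1)
    (fun h => Finset.disjoint_left.1 c.dAC ha1 (h ▸ hc1)) hva hvc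

lemma no_both (c : Conf G F k n T0 A0 C0) {v a b : V} (ha : a ∈ sA G n C0) (hb : b ∈ sA G n A0)
    (h1 : G.Adj v a) (h2 : G.Adj v b) : False :=
  c.no_both' ha hb (fun h => Finset.disjoint_left.1 c.AC_disj ha (h ▸ hb)) h1 h2

lemma no_F_TT (c : Conf G F k n T0 A0 C0) {x y : V} (hx : x ∈ sTT G n T0) (hy : y ∈ sTT G n T0) :
    ¬ F.Adj x y := fun h => by
  have := c.hk
  obtain ⟨S, hS, -⟩ := c.TT_path (p := 2 * k) (by omega) hx hy (X := ∅) h.ne (by simp) (by simp)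
    (by simp; omega)
  exact c.hF _ _ _ h hS

lemma FL_same (c : Conf G F k n T0 A0 C0) {u v v' : V} (hv : v ∈ sTT G n T0)
    (hv' : v' ∈ sTT G n T0) (hne : v ≠ v') (h : F.Adj v u) (h' : G.Adj v' u) : False := by
  have := c.hk
  obtain ⟨S, hS, hd⟩ := c.TT_path (p := 2 * k - 1) (by omega) hv hv' (X := {u}) hne
    (by simpa using h.ne) (by simpa using h'.ne) (by simp; omega)
  rw [Finset.disjoint_right] at hd
  exact c.hF _ _ _ h ((hS.snoc h' (hd (by simp))).cast (by omega))

lemma FL_adj (c : Conf G F k n T0 A0 C0) {u u' v v' : V} (hv : v ∈ sTT G n T0)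
    (hv' : v' ∈ sTT G n T0) (hu : u ∉ sTT G n T0) (hu' : u' ∉ sTT G n T0)
    (hne : v ≠ v') (h : F.Adj v u) (h' : G.Adj v' u') (huu : G.Adj u u') : False := by
  have := c.hk
  have c2 : ({u, u'} : Finset V).card ≤ 2 := Finset.card_le_two
  obtain ⟨S, hS, hd⟩ := c.TT_path (p := 2 * k - 2) (by omega) hv hv' (X := {u, u'}) hne
    (by simp only [Finset.mem_insert, Finset.mem_singleton, not_or]
        exact ⟨h.ne, fun e => hu' (e ▸ hv)⟩)
    (by simp only [Finset.mem_insert, Finset.mem_singleton, not_or]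
        exact ⟨fun e => hu (e ▸ hv'), h'.ne⟩) (by omega)
  rw [Finset.disjoint_right] at hd
  exact c.hF _ _ _ h (((hS.snoc h' (hd (by simp))).snoc huu.symm
    (by simp only [Finset.mem_insert, not_or]; exact ⟨huu.ne, hd (by simp)⟩)).cast (by omega))

lemma FL_side (c : Conf G F k n T0 A0 C0) {u u' v v' : V} (hv : v ∈ sTT G n T0)
    (hv' : v' ∈ sTT G n T0) (hu : u ∉ sTT G n T0) (hu' : u' ∉ sTT G n T0)
    (hne : v ≠ v') (h : F.Adj v u) (h' : G.Adj v' u') (hA : u ∈ sA G n C0)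
    (hA' : u' ∈ sA G n C0) : False := by
  have := c.hk
  have hpos := c.npos
  by_cases huu : u = u'
  · subst huu; exact c.FL_same hv hv' hne h h'
  rw [mem_sA] at hA hA'
  have c2 : ({v, v'} : Finset V).card ≤ 2 := Finset.card_le_two
  obtain ⟨z, hz, huz, huz', hzX⟩ := pick_common (H := G) (G := G) (v := u) (w := u') (B := C0)
    (X := {v, v'}) (c.small (by omega) (by have := c.cC; linarith))
  simp only [Finset.mem_insert, Finset.mem_singleton, not_or] at hzX
  have c3 : ({u, u', z} : Finset V).card ≤ 3 := Finset.card_le_three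
  obtain ⟨S, hS, hd⟩ := c.TT_path (p := 2 * k - 3) (by omega) hv hv' (X := {u, u', z}) hne
    (by simp only [Finset.mem_insert, Finset.mem_singleton, not_or]
        exact ⟨h.ne, fun e => hu' (e ▸ hv), fun e => hzX.1 e.symm⟩)
    (by simp only [Finset.mem_insert, Finset.mem_singleton, not_or]
        exact ⟨fun e => hu (e ▸ hv'), h'.ne, fun e => hzX.2 e.symm⟩) (by omega)
  rw [Finset.disjoint_right] at hd
  have h1 := hS.snoc h' (hd (by simp))
  have h2 := h1.snoc huz'
    (by simp only [Finset.mem_insert, not_or]; exact ⟨huz'.ne', hd (by simp)⟩)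
  have h3 := h2.snoc huz.symm
    (by simp only [Finset.mem_insert, not_or]; exact ⟨huz.ne, huu, hd (by simp)⟩)
  exact c.hF _ _ _ h (h3.cast (by omega))

lemma GL_opp (c : Conf G F k n T0 A0 C0) {u u' v v' : V} (hv : v ∈ sT G n T0)
    (hv' : v' ∈ sT G n T0) (hu : u ∉ sTT G n T0) (hu' : u' ∉ sTT G n T0)
    (hne : v ≠ v') (h : G.Adj v u) (h' : G.Adj v' u') (hA : u ∈ sA G n C0)
    (hA' : u' ∈ sA G n A0) : False := by
  have := c.hk
  have c2 : ({u, u'} : Finset V).card ≤ 2 := Finset.card_le_two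
  have huu : u ≠ u' := fun e => Finset.disjoint_left.1 c.AC_disj hA (e ▸ hA')
  obtain ⟨S, hS, hd⟩ := c.T_path (p := 2 * k - 4) (by omega) hv hv' (X := {u, u'}) hne
    (by simp only [Finset.mem_insert, Finset.mem_singleton, not_or]
        exact ⟨h.ne, fun e => hu' (e ▸ c.T_sub hv)⟩)
    (by simp only [Finset.mem_insert, Finset.mem_singleton, not_or]
        exact ⟨fun e => hu (e ▸ c.T_sub hv'), h'.ne⟩) (by omega)
  rw [Finset.disjoint_right] at hd
  have h1 := hS.snoc h' (hd (by simp))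
  have h2 := h1.symm.snoc h
    (by simp only [Finset.mem_insert, not_or]; exact ⟨huu, hd (by simp)⟩)
  exact c.closeAC (j := 0) hA hA' h2 (by omega)

lemma GL_same (c : Conf G F k n T0 A0 C0) {u u' v v' z : V} (hv : v ∈ sT G n T0)
    (hv' : v' ∈ sT G n T0) (hu : u ∉ sTT G n T0) (hu' : u' ∉ sTT G n T0) (hz : z ∉ sTT G n T0)
    (hne : v ≠ v') (huu : u ≠ u') (h : G.Adj v u) (h' : G.Adj v' u') (hF : F.Adj u z)
    (hG : G.Adj u' z) : False := by
  have := c.hk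
  have c3 : ({u, u', z} : Finset V).card ≤ 3 := Finset.card_le_three
  obtain ⟨S, hS, hd⟩ := c.T_path (p := 2 * k - 3) (by omega) hv hv' (X := {u, u', z}) hne
    (by simp only [Finset.mem_insert, Finset.mem_singleton, not_or]
        exact ⟨h.ne, fun e => hu' (e ▸ c.T_sub hv), fun e => hz (e ▸ c.T_sub hv)⟩)
    (by simp only [Finset.mem_insert, Finset.mem_singleton, not_or]
        exact ⟨fun e => hu (e ▸ c.T_sub hv'), h'.ne, fun e => hz (e ▸ c.T_sub hv')⟩) (by omega)
  rw [Finset.disjoint_right] at hd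
  have h1 := hS.snoc h' (hd (by simp))
  have h2 := h1.snoc hG
    (by simp only [Finset.mem_insert, not_or]; exact ⟨hG.ne', hd (by simp)⟩)
  have h3 := PS.cons h.symm h2
    (by simp only [Finset.mem_insert, not_or]; exact ⟨hF.ne, huu, hd (by simp)⟩)
  exact c.hF _ _ _ hF (h3.cast (by omega))

end Conf
end conf


/-! ## The extremal configuration: counting -/

lemma final_arith {N t q b c d m : ℕ} {f : ℝ} (hsum : N = t + q + b + c + d) (hn : 50000 ≤ N)
    (he : (b : ℝ) + c + d ≤ 0.001 * N) (hq : (1 / 3 - 0.002) * (N : ℝ) ≤ q)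
    (htl : (2 / 3 - 0.003) * (N : ℝ) ≤ t) (htu : (t : ℝ) ≤ (2 / 3 + 0.002) * N)
    (hd : d = 0 ∨ 2 ≤ d) (hm : m = (N + 1) / 3)
    (hG : (N : ℝ) ^ 2 + 3 ≤ 2 * (t * (t - 1)) + (q + 1) ^ 2
      + 4 * (0.58 * N * b + (1 / 6 - 0.004) * N * c + (1 / 6 + 0.005) * N * d))
    (hf : f ≤ (q + 1) ^ 2 + 4 * ((1 / 6 - 0.004) * N * c + 0.013 * N * d)) : f ≤ (m : ℝ) ^ 2 := by
  have hsr : (N : ℝ) = t + q + b + c + d := by exact_mod_cast hsum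
  have hnr : (50000 : ℝ) ≤ N := by exact_mod_cast hn
  have hb0 : (0:ℝ) ≤ b := Nat.cast_nonneg _
  have hc0 : (0:ℝ) ≤ c := Nat.cast_nonneg _
  have hd0 : (0:ℝ) ≤ d := Nat.cast_nonneg _
  have hq0 : (0:ℝ) ≤ q := Nat.cast_nonneg _
  have key : (-0.5 * b + 2 * c + 1.9 * d : ℝ) < t - 1 - 2 * q := by
    by_contra hcon
    push Not at hcon
    set e : ℝ := b + c + d with hedef
    have h1 : ((t:ℝ) - 1) * (t - 1 - 2 * q) ≤ (t - 1) * (-0.5 * b + 2 * c + 1.9 * d) := by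
      apply mul_le_mul_of_nonneg_left hcon; linarith
    have h2 : (N : ℝ) ^ 2 = (t + q) ^ 2 + 2 * N * e - e ^ 2 := by
      have : (N : ℝ) = t + q + e := by rw [hedef]; linarith
      have h3 : (t : ℝ) + q = N - e := by linarith
      rw [h3]; ring
    have h3 : 2 * ((t:ℝ) * (t - 1)) + (q + 1) ^ 2 = (t + q) ^ 2 + (t - 1) * (t - 1 - 2 * q) := by ring
    have h4 : e ^ 2 ≤ 0.001 * N * e := by
      have : 0 ≤ e := by positivity
      nlinarith
    have h5 : ((t:ℝ) - 1) * b ≥ 0.66 * N * b := by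
      apply mul_le_mul_of_nonneg_right _ hb0; linarith
    have h6 : ((t:ℝ) - 1) * c ≤ (2 / 3 + 0.002) * N * c := by
      apply mul_le_mul_of_nonneg_right _ hc0; linarith
    have h7 : ((t:ℝ) - 1) * d ≤ (2 / 3 + 0.002) * N * d := by
      apply mul_le_mul_of_nonneg_right _ hd0; linarith
    have h8 : N * e = N * b + N * c + N * d := by rw [hedef]; ring
    have p1 : (0:ℝ) ≤ N * b := by positivity
    have p2 : (0:ℝ) ≤ N * c := by positivity
    have p3 : (0:ℝ) ≤ N * d := by positivity
    linarith
  have hlow : (1 / 3 - 0.002) * (N : ℝ) * c ≤ q * c := mul_le_mul_of_nonneg_right hq hc0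
  have hlow2 : (1 / 3 - 0.002) * (N : ℝ) * d ≤ q * d := mul_le_mul_of_nonneg_right hq hd0
  have p2 : (0:ℝ) ≤ N * c := by positivity
  have p3 : (0:ℝ) ≤ N * d := by positivity
  rcases hd with rfl | hd
  · rw [Nat.cast_zero] at hf key
    have h1 : (3 * q + 3 * c : ℝ) < N - 1 := by push_cast at hsr; linarith
    have h2 : 3 * q + 3 * c + 1 < N := by
      have : ((3 * q + 3 * c + 1 : ℕ) : ℝ) < N := by push_cast; linarith
      exact_mod_cast this
    have h3 : q + c + 1 ≤ m := by omega
    have h4 : (q : ℝ) + c + 1 ≤ m := by exact_mod_cast h3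
    have h5 : ((q : ℝ) + c + 1) ^ 2 ≤ (m : ℝ) ^ 2 := by gcongr
    have h6 : ((q : ℝ) + c + 1) ^ 2 = (q + 1) ^ 2 + 2 * (q * c) + 2 * c + c ^ 2 := by ring
    have h7 : (0:ℝ) ≤ (c:ℝ) ^ 2 := sq_nonneg _
    linarith
  · have hd2 : (2:ℝ) ≤ d := by exact_mod_cast hd
    have h1 : N ≤ 3 * m + 1 := by omega
    have h2 : (N : ℝ) ≤ 3 * m + 1 := by exact_mod_cast h1
    have h3 : (q : ℝ) + 1 + (c + 0.4 * d) ≤ m := by linarith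
    have h5 : ((q : ℝ) + 1 + (c + 0.4 * d)) ^ 2 ≤ (m : ℝ) ^ 2 := by gcongr
    have h6 : ((q : ℝ) + 1) ^ 2 + 2 * (q * c + 0.4 * (q * d)) ≤ ((q : ℝ) + 1 + (c + 0.4 * d)) ^ 2 := by
      have : 0 ≤ (c + 0.4 * d : ℝ) ^ 2 := sq_nonneg _
      linarith [(by ring : ((q : ℝ) + 1 + (c + 0.4 * d)) ^ 2 = ((q : ℝ) + 1) ^ 2
        + 2 * (q * c + 0.4 * (q * d)) + 2 * (c + 0.4 * d) + (c + 0.4 * d : ℝ) ^ 2)]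
    linarith

lemma ee_cover {V : Type*} [Fintype V] [DecidableEq V] (H : SimpleGraph V) {A B E : Finset V}
    (h : ∀ v, v ∈ A ∨ v ∈ B ∨ v ∈ E) :
    ee H Finset.univ Finset.univ ≤ ee H A A + 2 * ee H B A + ee H B B + 2 * ee H E Finset.univ := by
  have hu : (Finset.univ : Finset V) = (A ∪ B) ∪ E := by
    ext v; simp only [Finset.mem_univ, Finset.mem_union, true_iff]
    rcases h v with h | h | h <;> simp [h]
  have h1 : ee H Finset.univ Finset.univ ≤ ee H (A ∪ B) Finset.univ + ee H E Finset.univ := by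
    conv_lhs => rw [hu]
    refine (ee_union_left_le _ _ _ _).trans ?_
    rw [← hu]
  have h2 : ee H (A ∪ B) Finset.univ ≤ ee H (A ∪ B) (A ∪ B) + ee H (A ∪ B) E := by
    conv_lhs => rw [hu]
    exact ee_union_right_le _ _ _ _
  have h3 : ee H (A ∪ B) E ≤ ee H E Finset.univ := by
    rw [ee_comm]; exact ee_mono H (Finset.Subset.refl _) (Finset.subset_univ _)
  have h4 := ee_union_left_le H A B (A ∪ B)
  have h5 := ee_union_right_le H A B A
  have h6 := ee_union_right_le H A B B
  rw [ee_comm H A B] at h5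
  linarith

section conf
set_option linter.unusedSectionVars false
variable {V : Type*} [Fintype V] [DecidableEq V] {G F : SimpleGraph V} {k : ℕ} {n : ℝ}
  {T0 A0 C0 : Finset V}

namespace Conf

lemma deg_split (c : Conf G F k n T0 A0 C0) (H : SimpleGraph V) (v : V) :
    dg H v Finset.univ ≤ dg H v T0 + dg H v A0 + dg H v C0 + 0.001 * n := by
  set U := T0 ∪ A0 ∪ C0 with hU
  have h1 : dg H v Finset.univ = dg H v U + dg H v (Finset.univ \ U) := by
    rw [← dg_union H v Finset.disjoint_sdiff, Finset.union_sdiff_of_subset (Finset.subset_univ _)]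
  have h2 := dg_union_le H v (T0 ∪ A0) C0
  have h3 := dg_union_le H v T0 A0
  have h4 := dg_le_card H v (Finset.univ \ U)
  have h5 : (U.card : ℝ) = T0.card + A0.card + C0.card := by
    rw [hU, Finset.card_union_of_disjoint, Finset.card_union_of_disjoint c.dTA]
    · push_cast; ring
    · rw [Finset.disjoint_union_left]; exact ⟨c.dTC, c.dAC⟩
  rw [card_sdiff_real (Finset.subset_univ _), Finset.card_univ, c.hV] at h4
  have := c.rest
  linarith

lemma one_side (c : Conf G F k n T0 A0 C0) (v : V) :
    (∀ a ∈ sA G n C0, ¬ G.Adj v a) ∨ (∀ b ∈ sA G n A0, ¬ G.Adj v b) := by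
  by_contra h
  push Not at h
  obtain ⟨⟨a, ha, h1⟩, b, hb, h2⟩ := h
  exact c.no_both ha hb h1 h2

lemma deg_b (c : Conf G F k n T0 A0 C0) {v : V} (hv : v ∉ sT G n T0) :
    dg G v Finset.univ ≤ 0.58 * n := by
  have hpos := c.npos
  have h := c.deg_split G v
  rw [mem_sT, not_le] at hv
  rcases c.one_side v with h1 | h1
  · have : dg G v A0 = 0 := dg_zero fun b hb => h1 b (c.A0_sub hb)
    have := dg_le_card G v C0
    have := c.cC
    linarith
  · have : dg G v C0 = 0 := dg_zero fun b hb => h1 b (c.swap.A0_sub hb)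
    have := dg_le_card G v A0
    have := c.cA
    linarith

lemma deg_c (c : Conf G F k n T0 A0 C0) {v : V} (hv : v ∉ sTT G n T0) (hA : v ∉ sA G n C0)
    (hC : v ∉ sA G n A0) : dg G v Finset.univ ≤ (1 / 6 - 0.004) * n := by
  have hpos := c.npos
  have h := c.deg_split G v
  rw [mem_sTT, not_le] at hv
  rw [mem_sA, not_le] at hA hC
  rcases c.one_side v with h1 | h1
  · have : dg G v A0 = 0 := dg_zero fun b hb => h1 b (c.A0_sub hb)
    linarith
  · have : dg G v C0 = 0 := dg_zero fun b hb => h1 b (c.swap.A0_sub hb)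
    linarith

lemma deg_q (c : Conf G F k n T0 A0 C0) {v : V} (hv : v ∉ sTT G n T0) :
    dg G v Finset.univ ≤ (1 / 6 + 0.005) * n := by
  have hpos := c.npos
  have h := c.deg_split G v
  rw [mem_sTT, not_le] at hv
  rcases c.one_side v with h1 | h1
  · have : dg G v A0 = 0 := dg_zero fun b hb => h1 b (c.A0_sub hb)
    have := dg_le_card G v C0
    have := c.cC
    linarith
  · have : dg G v C0 = 0 := dg_zero fun b hb => h1 b (c.swap.A0_sub hb)
    have := dg_le_card G v A0
    have := c.cA
    linarith

lemma QB (c : Conf G F k n T0 A0 C0) {H : SimpleGraph V} (hH : H ≤ G) {Q W : Finset V}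
    (hQ : Q ⊆ sA G n C0 ∪ sA G n A0)
    (hW : (∃ v, ∀ u ∈ Q, ∀ w ∈ W, H.Adj u w → w = v) ∨ ee H Q W ≤ (Q.card : ℝ) / 2) :
    2 * ee H Q Q + 4 * ee H Q W ≤ ((Q.card : ℝ) + 1) ^ 2 := by
  set Qa := fs Q (fun u => u ∈ sA G n C0) with hQa
  set Qc := Q \ Qa with hQc
  have hQas : Qa ⊆ Q := fs_sub _ _
  have ha : ∀ u ∈ Qa, u ∈ sA G n C0 := fun u hu => (mem_fs.1 hu).2
  have hc : ∀ u ∈ Qc, u ∈ sA G n A0 := fun u hu => by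
    rw [hQc, Finset.mem_sdiff, hQa, mem_fs] at hu
    rcases Finset.mem_union.1 (hQ hu.1) with h | h
    · exact absurd ⟨hu.1, h⟩ hu.2
    · exact h
  have hdis : Disjoint Qa Qc := Finset.disjoint_sdiff
  have hun : Q = Qa ∪ Qc := (Finset.union_sdiff_of_subset hQas).symm
  have hcard : (Q.card : ℝ) = Qa.card + Qc.card := by
    rw [hQc, card_sdiff_real hQas]; ring
  have e1 : ee H Q Q = 2 * ee H Qa Qc := by
    have b4 : ee H (Qa ∪ Qc) (Qa ∪ Qc) = ee H Qa Qa + ee H Qa Qc + (ee H Qc Qa + ee H Qc Qc) := by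
      rw [ee_union_left H _ hdis, ee_union_right H _ hdis, ee_union_right H _ hdis]
    have b5 : ee H Qa Qa = 0 := ee_zero fun v hv w hw h =>
      c.A_indep (ha v hv) (ha w hw) (hH h)
    have b6 : ee H Qc Qc = 0 := ee_zero fun v hv w hw h =>
      c.swap.A_indep (hc v hv) (hc w hw) (hH h)
    rw [ee_comm H Qc Qa] at b4
    rw [hun]; linarith
  have e2 := ee_le_mul H Qa Qc
  set x : ℝ := (Qa.card : ℝ)
  set y : ℝ := (Qc.card : ℝ)
  rcases hW with ⟨v, hv⟩ | hW
  · have h1 : ee H Q W ≤ dg H v Q := by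
      have : ee H Q W ≤ ee H Q {v} := by
        apply Finset.sum_le_sum
        intro u hu
        rw [dg_eq_card, dg_eq_card]
        have : nb H u W ⊆ nb H u {v} := fun w hw => by
          rw [mem_nb] at hw ⊢
          exact ⟨by simpa using hv u hu w hw.1 hw.2, hw.2⟩
        exact_mod_cast Finset.card_le_card this
      rw [ee_comm H Q {v}] at this
      simpa [ee] using this
    have h2 : dg H v Q = dg H v Qa + dg H v Qc := by rw [hun, dg_union H v hdis]
    have hsq : (Q.card : ℝ) = x + y := hcard
    rcases c.one_side v with h3 | h3
    · have h4 : dg H v Qa = 0 := dg_zero fun b hb h => h3 b (ha b hb) (hH h)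
      have h5 : dg H v Qc ≤ y := dg_le_card _ _ _
      rw [hsq]; nlinarith [sq_nonneg (x - y + 1)]
    · have h4 : dg H v Qc = 0 := dg_zero fun b hb h => h3 b (hc b hb) (hH h)
      have h5 : dg H v Qa ≤ x := dg_le_card _ _ _
      rw [hsq]; nlinarith [sq_nonneg (x - y - 1)]
  · rw [hcard] at hW ⊢
    nlinarith [sq_nonneg (x - y)]

lemma bad_card (c : Conf G F k n T0 A0 C0) {u : V} (hu : u ∈ sA G n C0) {B : Finset V}
    (hB : ∀ z ∈ B, z ∉ sTT G n T0 ∧ z ∉ sA G n C0 ∧ ¬ G.Adj u z) : (B.card : ℝ) ≤ 0.01 * n := by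
  have hsub : B ⊆ (C0 \ nb G u C0) ∪ (Finset.univ \ (T0 ∪ A0 ∪ C0)) := by
    intro z hz
    obtain ⟨h1, h2, h3⟩ := hB z hz
    simp only [Finset.mem_union, Finset.mem_sdiff, mem_nb, Finset.mem_univ, true_and, not_or]
    by_cases hc : z ∈ C0
    · left; exact ⟨hc, fun h => h3 h.2⟩
    · right
      exact ⟨⟨fun h => h1 (c.T_sub (c.T0_sub h)), fun h => h2 (c.A0_sub h)⟩, hc⟩
  have h1 := Finset.card_le_card hsub
  have h2 := h1.trans (Finset.card_union_le _ _)
  have h3 : (B.card : ℝ) ≤ ((C0 \ nb G u C0).card : ℝ) + ((Finset.univ \ (T0 ∪ A0 ∪ C0)).card : ℝ) := by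
    exact_mod_cast h2
  have h5 : ((T0 ∪ A0 ∪ C0).card : ℝ) = T0.card + A0.card + C0.card := by
    rw [Finset.card_union_of_disjoint, Finset.card_union_of_disjoint c.dTA]
    · push_cast; ring
    · rw [Finset.disjoint_union_left]; exact ⟨c.dTC, c.dAC⟩
  rw [card_sdiff_real (nb_sub _ _ _), card_sdiff_real (Finset.subset_univ _), ← dg_eq_card, h5,
    Finset.card_univ, c.hV] at h3
  rw [mem_sA] at hu
  have := c.rest
  have := c.cC
  linarith

/-- the F-links at the clique part -/
lemma F_links (c : Conf G F k n T0 A0 C0) {Q : Finset V} (hQ : Q ⊆ sA G n C0 ∪ sA G n A0)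
    (hQT : ∀ u ∈ Q, u ∉ sTT G n T0) (hq : 0.04 * n ≤ Q.card) :
    (∃ v, ∀ u ∈ Q, ∀ w ∈ sTT G n T0, F.Adj u w → w = v) ∨
      ee F Q (sTT G n T0) ≤ (Q.card : ℝ) / 2 := by
  by_cases h : ∃ v, ∀ u ∈ Q, ∀ w ∈ sTT G n T0, F.Adj u w → w = v
  · exact Or.inl h
  right
  push Not at h
  have hpos := c.npos
  have hne : Nonempty V := by
    rw [← Fintype.card_pos_iff]
    have := c.hV
    have : (0:ℝ) < Fintype.card V := by linarith
    exact_mod_cast this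
  obtain ⟨v0⟩ := hne
  obtain ⟨u1, hu1, w1, hw1, h1, -⟩ := h v0
  obtain ⟨u2, hu2, w2, hw2, h2, hw21⟩ := h w1
  -- the bad set of a vertex
  have bad : ∀ u ∈ Q, ∃ B : Finset V, (B.card : ℝ) ≤ 0.01 * n ∧ ∀ w ∈ sTT G n T0, F.Adj u w →
      ∀ u' ∈ Q, ∀ w' ∈ sTT G n T0, F.Adj u' w' → w' ≠ w → u' ∈ B := by
    intro u hu
    rcases Finset.mem_union.1 (hQ hu) with hA | hC
    · refine ⟨fs Q (fun z => z ∉ sA G n C0 ∧ ¬ G.Adj u z), c.bad_card hA ?_, ?_⟩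
      · intro z hz; rw [mem_fs] at hz; exact ⟨hQT z hz.1, hz.2⟩
      · intro w hw huw u' hu' w' hw' huw' hne
        rw [mem_fs]
        refine ⟨hu', fun hA' => ?_, fun hadj => ?_⟩
        · exact c.FL_side hw hw' (hQT _ hu) (hQT _ hu') hne.symm huw.symm (c.hFG huw'.symm) hA hA'
        · exact c.FL_adj hw hw' (hQT _ hu) (hQT _ hu') hne.symm huw.symm (c.hFG huw'.symm) hadj
    · refine ⟨fs Q (fun z => z ∉ sA G n A0 ∧ ¬ G.Adj u z), c.swap.bad_card hC ?_, ?_⟩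
      · intro z hz; rw [mem_fs] at hz; exact ⟨hQT z hz.1, hz.2⟩
      · intro w hw huw u' hu' w' hw' huw' hne
        rw [mem_fs]
        refine ⟨hu', fun hA' => ?_, fun hadj => ?_⟩
        · exact c.swap.FL_side hw hw' (hQT _ hu) (hQT _ hu') hne.symm huw.symm (c.hFG huw'.symm) hC hA'
        · exact c.FL_adj hw hw' (hQT _ hu) (hQT _ hu') hne.symm huw.symm (c.hFG huw'.symm) hadj
  obtain ⟨B1, hB1c, hB1⟩ := bad u1 hu1
  obtain ⟨B2, hB2c, hB2⟩ := bad u2 hu2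
  have hB : ∀ u ∈ Q, ∀ w ∈ sTT G n T0, F.Adj u w → u ∈ B1 ∪ B2 := by
    intro u hu w hw huw
    rw [Finset.mem_union]
    by_cases e : w = w1
    · right; exact hB2 w2 hw2 h2 u hu w hw huw (by rw [e]; exact hw21.symm)
    · left; exact hB1 w1 hw1 h1 u hu w hw huw e
  have hone : ∀ u, dg F u (sTT G n T0) ≤ 1 := by
    intro u
    rw [dg_eq_card]
    have : (nb F u (sTT G n T0)).card ≤ 1 := by
      rw [Finset.card_le_one]
      intro a ha b hb
      rw [mem_nb] at ha hb
      by_contra hab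
      exact c.FL_same ha.1 hb.1 hab ha.2.symm (c.hFG hb.2.symm)
    exact_mod_cast this
  have hcb : (((B1 ∪ B2)).card : ℝ) ≤ B1.card + B2.card := by
    exact_mod_cast Finset.card_union_le _ _
  have s1 : ee F Q (sTT G n T0) ≤ ee F (Q ∩ (B1 ∪ B2)) (sTT G n T0) := by
    have hu : Q = (Q ∩ (B1 ∪ B2)) ∪ (Q \ (B1 ∪ B2)) := by
      ext z; simp only [Finset.mem_union, Finset.mem_inter, Finset.mem_sdiff]; tauto
    have h0 : ee F (Q \ (B1 ∪ B2)) (sTT G n T0) = 0 := ee_zero fun a ha b hb hab => by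
      rw [Finset.mem_sdiff] at ha
      exact ha.2 (hB a ha.1 b hb hab)
    have := ee_union_left_le F (Q ∩ (B1 ∪ B2)) (Q \ (B1 ∪ B2)) (sTT G n T0)
    rw [← hu, h0] at this
    linarith
  have s2 : ee F (Q ∩ (B1 ∪ B2)) (sTT G n T0) ≤ ((Q ∩ (B1 ∪ B2)).card : ℝ) * 1 :=
    ee_le_const fun a _ => hone a
  have s3 : ((Q ∩ (B1 ∪ B2)).card : ℝ) ≤ (B1 ∪ B2).card := by
    exact_mod_cast Finset.card_le_card Finset.inter_subset_right
  linarith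

/-- F-degree bound for a vertex with a pair of disjoint links on one side -/
lemma degF_link (c : Conf G F k n T0 A0 C0) {u u' v v' : V} (hv : v ∈ sT G n T0)
    (hv' : v' ∈ sT G n T0) (hu : u ∉ sTT G n T0) (hu' : u' ∉ sTT G n T0)
    (hne : v ≠ v') (huu : u ≠ u') (h : G.Adj v u) (h' : G.Adj v' u')
    (hA : u ∈ sA G n C0) (hA' : u' ∈ sA G n C0) : dg F u Finset.univ ≤ 0.013 * n := by
  have hpos := c.npos
  have h0 := c.deg_split F u
  have h1 : dg F u T0 ≤ 0.003 * n := by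
    rw [mem_sTT, not_le] at hu
    have := dg_mono_graph c.hFG u T0
    linarith
  have h2 : dg F u A0 = 0 := dg_zero fun b hb hab => c.A_indep hA (c.A0_sub hb) (c.hFG hab)
  have h3 : dg F u C0 ≤ C0.card - dg G u' C0 := by
    have hsub : nb F u C0 ⊆ C0 \ nb G u' C0 := by
      intro z hz
      rw [mem_nb] at hz
      rw [Finset.mem_sdiff, mem_nb]
      exact ⟨hz.1, fun hz' => c.GL_same hv hv' hu hu' (c.swap.A0_not_TT hz.1) hne huu h h' hz.2 hz'.2⟩
    have : ((nb F u C0).card : ℝ) ≤ (C0 \ nb G u' C0).card := by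
      exact_mod_cast Finset.card_le_card hsub
    rw [card_sdiff_real (nb_sub _ _ _), ← dg_eq_card, ← dg_eq_card] at this
    exact this
  rw [mem_sA] at hA'
  have := c.cC
  linarith

/-- the G-links at the clique part -/
lemma G_links (c : Conf G F k n T0 A0 C0) {Q : Finset V} (hQ : Q ⊆ sA G n C0 ∪ sA G n A0)
    (hQT : ∀ u ∈ Q, u ∉ sTT G n T0) (hq : 0.04 * n ≤ Q.card) :
    ∃ N ⊆ Q, ((∃ v, ∀ u ∈ Q \ N, ∀ w ∈ sT G n T0, G.Adj u w → w = v) ∨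
      ee G (Q \ N) (sT G n T0) ≤ ((Q \ N).card : ℝ) / 2) ∧ (N.card = 0 ∨ 2 ≤ N.card) ∧
      ∀ u ∈ N, dg F u Finset.univ ≤ 0.013 * n := by
  have hpos := c.npos
  by_cases hdis : ∃ u1 ∈ Q, ∃ u2 ∈ Q, ∃ w1 ∈ sT G n T0, ∃ w2 ∈ sT G n T0,
      u1 ≠ u2 ∧ w1 ≠ w2 ∧ G.Adj u1 w1 ∧ G.Adj u2 w2
  · obtain ⟨u1, hu1, u2, hu2, w1, hw1, w2, hw2, huu, hww, h1, h2⟩ := hdis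
    refine ⟨fs Q (fun u => ∃ w ∈ sT G n T0, G.Adj u w), fs_sub _ _, ?_, ?_, ?_⟩
    · left
      refine ⟨u1, ?_⟩
      intro u hu w hw huw
      rw [Finset.mem_sdiff, mem_fs] at hu
      exact absurd ⟨hu.1, w, hw, huw⟩ hu.2
    · right
      have : ({u1, u2} : Finset V) ⊆ fs Q (fun u => ∃ w ∈ sT G n T0, G.Adj u w) := by
        intro z hz
        simp only [Finset.mem_insert, Finset.mem_singleton] at hz
        rw [mem_fs]
        rcases hz with rfl | rfl
        · exact ⟨hu1, w1, hw1, h1⟩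
        · exact ⟨hu2, w2, hw2, h2⟩
      have h3 := Finset.card_le_card this
      rwa [Finset.card_pair huu] at h3
    · intro u hu
      rw [mem_fs] at hu
      obtain ⟨huQ, w, hw, huw⟩ := hu
      have hex : ∃ w ∈ sT G n T0, ∃ u' ∈ Q, ∃ w' ∈ sT G n T0, u ≠ u' ∧ w ≠ w' ∧ G.Adj u w ∧
          G.Adj u' w' := by
        by_cases e1 : u = u1
        · subst e1; exact ⟨w1, hw1, u2, hu2, w2, hw2, huu, hww, h1, h2⟩
        by_cases e2 : u = u2
        · subst e2; exact ⟨w2, hw2, u1, hu1, w1, hw1, huu.symm, hww.symm, h2, h1⟩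
        by_cases e3 : w = w1
        · subst e3; exact ⟨w, hw, u2, hu2, w2, hw2, e2, hww, huw, h2⟩
        · exact ⟨w, hw, u1, hu1, w1, hw1, e1, e3, huw, h1⟩
      obtain ⟨w, hw, u', hu', w', hw', hne1, hne2, hadj, hadj'⟩ := hex
      rcases Finset.mem_union.1 (hQ huQ) with hA | hC <;>
        rcases Finset.mem_union.1 (hQ hu') with hA' | hC'
      · exact c.degF_link hw hw' (hQT _ huQ) (hQT _ hu') hne2 hne1 hadj.symm hadj'.symm hA hA'
      · exact (c.GL_opp hw hw' (hQT _ huQ) (hQT _ hu') hne2 hadj.symm hadj'.symm hA hC').elim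
      · exact (c.swap.GL_opp hw hw' (hQT _ huQ) (hQT _ hu') hne2 hadj.symm hadj'.symm hC hA').elim
      · exact c.swap.degF_link hw hw' (hQT _ huQ) (hQT _ hu') hne2 hne1 hadj.symm hadj'.symm hC hC'
  · push Not at hdis
    refine ⟨∅, by simp, ?_, by simp, by simp⟩
    rw [Finset.sdiff_empty]
    by_cases h : ∃ v, ∀ u ∈ Q, ∀ w ∈ sT G n T0, G.Adj u w → w = v
    · exact Or.inl h
    right
    push Not at h
    have hne : Nonempty V := by
      rw [← Fintype.card_pos_iff]
      have := c.hV
      have : (0:ℝ) < Fintype.card V := by linarith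
      exact_mod_cast this
    obtain ⟨v0⟩ := hne
    obtain ⟨u1, hu1, w1, hw1, h1, -⟩ := h v0
    obtain ⟨u2, hu2, w2, hw2, h2, hw21⟩ := h w1
    have e12 : u1 = u2 := by
      by_contra e
      exact hdis u1 hu1 u2 hu2 w1 hw1 w2 hw2 e hw21.symm h1 h2
    subst e12
    have hall : ∀ u ∈ Q, ∀ w ∈ sT G n T0, G.Adj u w → u = u1 := by
      intro u hu w hw huw
      by_contra e
      by_cases e3 : w = w1
      · exact hdis u hu u1 hu1 w hw w2 hw2 e (by rw [e3]; exact hw21.symm) huw h2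
      · exact hdis u hu u1 hu1 w hw w1 hw1 e e3 huw h1
    have s1 : ee G Q (sT G n T0) ≤ dg G u1 (sT G n T0) := by
      unfold ee
      rw [Finset.sum_eq_single_of_mem u1 hu1]
      intro b hb hb1
      exact dg_zero fun w hw hbw => hb1 (hall b hb w hw hbw)
    have s2 : dg G u1 (sT G n T0) ≤ 0.004 * n := by
      have hu := hQT u1 hu1
      rw [mem_sTT, not_le] at hu
      have hs : sT G n T0 ⊆ T0 ∪ (Finset.univ \ (T0 ∪ A0 ∪ C0)) := by
        intro z hz
        simp only [Finset.mem_union, Finset.mem_sdiff, Finset.mem_univ, true_and, not_or]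
        by_cases hz0 : z ∈ T0
        · exact Or.inl hz0
        · exact Or.inr ⟨⟨hz0, fun h => c.A0_not_TT h (c.T_sub hz)⟩,
            fun h => c.swap.A0_not_TT h (c.T_sub hz)⟩
      have a1 := dg_mono G u1 hs
      have a2 := dg_union_le G u1 T0 (Finset.univ \ (T0 ∪ A0 ∪ C0))
      have a3 := dg_le_card G u1 (Finset.univ \ (T0 ∪ A0 ∪ C0))
      have h5 : ((T0 ∪ A0 ∪ C0).card : ℝ) = T0.card + A0.card + C0.card := by
        rw [Finset.card_union_of_disjoint, Finset.card_union_of_disjoint c.dTA]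
        · push_cast; ring
        · rw [Finset.disjoint_union_left]; exact ⟨c.dTC, c.dAC⟩
      rw [card_sdiff_real (Finset.subset_univ _), Finset.card_univ, c.hV, h5] at a3
      have := c.rest
      linarith
    linarith

set_option maxHeartbeats 1000000 in
theorem final (c : Conf G F k n T0 A0 C0) {N m : ℕ} (hN : Fintype.card V = N)
    (hm : m = (N + 1) / 3) (hG : n ^ 2 + 3 ≤ 2 * ee G Finset.univ Finset.univ) :
    2 * ee F Finset.univ Finset.univ ≤ (m : ℝ) ^ 2 := by
  have hnN : n = N := by rw [← c.hV, hN]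
  have hpos := c.npos
  set T := sT G n T0 with hT
  set TT := sTT G n T0 with hTT
  set A := sA G n C0 with hA
  set C := sA G n A0 with hC
  set Q := (A ∪ C) \ TT with hQ
  have hQs : Q ⊆ A ∪ C := Finset.sdiff_subset
  have hQT : ∀ u ∈ Q, u ∉ TT := fun u hu => (Finset.mem_sdiff.1 hu).2
  have hcore : A0 ∪ C0 ⊆ Q := by
    intro z hz
    rw [hQ, Finset.mem_sdiff, Finset.mem_union]
    rcases Finset.mem_union.1 hz with h | h
    · exact ⟨Or.inl (c.A0_sub h), c.A0_not_TT h⟩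
    · exact ⟨Or.inr (c.swap.A0_sub h), c.swap.A0_not_TT h⟩
  have hcc : ((A0 ∪ C0).card : ℝ) = A0.card + C0.card := by
    rw [Finset.card_union_of_disjoint c.dAC]; push_cast; ring
  have hrest := c.rest
  have hcT := c.cT
  have hcA := c.cA
  have hcC := c.cC
  have hQc : ((A0 ∪ C0).card : ℝ) ≤ Q.card := by exact_mod_cast Finset.card_le_card hcore
  obtain ⟨D, hDQ, hDl, hDc, hDF⟩ := c.G_links hQs hQT (by linarith)
  set Q' := Q \ D with hQ'
  have hQ'Q : Q' ⊆ Q := Finset.sdiff_subset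
  have hDcore : A0 ∪ C0 ⊆ Q' := by
    intro z hz
    rw [hQ', Finset.mem_sdiff]
    refine ⟨hcore hz, fun hzD => ?_⟩
    have h1 := hDF z hzD
    rcases Finset.mem_union.1 hz with h | h
    · have := c.dA z h
      have := dg_mono F z (Finset.subset_univ C0)
      linarith
    · have := c.dC z h
      have := dg_mono F z (Finset.subset_univ A0)
      linarith
  have hQ'c : ((A0 ∪ C0).card : ℝ) ≤ Q'.card := by exact_mod_cast Finset.card_le_card hDcore
  have bG := c.QB (le_refl G) (hQ'Q.trans hQs) hDl
  have bF := c.QB c.hFG (hQ'Q.trans hQs)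
    (c.F_links (hQ'Q.trans hQs) (fun u hu => hQT u (hQ'Q hu)) (by linarith))
  set Eb := TT \ T with hEb
  set Ec := Finset.univ \ (TT ∪ Q) with hEc
  have hTTT : T ⊆ TT := c.T_sub
  have dTTQ : Disjoint TT Q := Finset.disjoint_sdiff
  -- cardinalities
  have hsum : N = T.card + Q'.card + Eb.card + Ec.card + D.card := by
    have h1 : Eb.card = TT.card - T.card := Finset.card_sdiff_of_subset hTTT
    have h2 : Q'.card = Q.card - D.card := Finset.card_sdiff_of_subset hDQ
    have h3 : Ec.card = N - (TT.card + Q.card) := by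
      rw [hEc, Finset.card_sdiff_of_subset (Finset.subset_univ _), Finset.card_univ, hN,
        Finset.card_union_of_disjoint dTTQ]
    have h4 := Finset.card_le_card hTTT
    have h5 := Finset.card_le_card hDQ
    have h6 : TT.card + Q.card ≤ N := by
      rw [← Finset.card_union_of_disjoint dTTQ, ← hN]; exact Finset.card_le_univ _
    omega
  have hsumr : n = T.card + Q'.card + Eb.card + Ec.card + D.card := by
    rw [hnN]; exact_mod_cast hsum
  have hTc : (T0.card : ℝ) ≤ T.card := by exact_mod_cast Finset.card_le_card c.T0_sub
  have hb0 : (0:ℝ) ≤ Eb.card := Nat.cast_nonneg _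
  have hc0 : (0:ℝ) ≤ Ec.card := Nat.cast_nonneg _
  have hd0 : (0:ℝ) ≤ D.card := Nat.cast_nonneg _
  -- degrees
  have hdb : ee G Eb Finset.univ ≤ Eb.card * (0.58 * n) := ee_le_const fun v hv =>
    c.deg_b (Finset.mem_sdiff.1 hv).2
  have hEcm : ∀ v ∈ Ec, v ∉ TT ∧ v ∉ A ∧ v ∉ C := by
    intro v hv
    rw [hEc, Finset.mem_sdiff, Finset.mem_union, hQ, Finset.mem_sdiff, Finset.mem_union] at hv
    tauto
  have hdc : ee G Ec Finset.univ ≤ Ec.card * ((1 / 6 - 0.004) * n) := ee_le_const fun v hv => by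
    obtain ⟨h1, h2, h3⟩ := hEcm v hv
    exact c.deg_c h1 h2 h3
  have hdd : ee G D Finset.univ ≤ D.card * ((1 / 6 + 0.005) * n) := ee_le_const fun v hv =>
    c.deg_q (hQT v (hDQ hv))
  have hdF : ee F D Finset.univ ≤ D.card * (0.013 * n) := ee_le_const hDF
  have hdcF : ee F Ec Finset.univ ≤ Ec.card * ((1 / 6 - 0.004) * n) :=
    (ee_mono_graph c.hFG _ _).trans hdc
  -- covers
  have cG := ee_cover G (A := T) (B := Q') (E := Eb ∪ (Ec ∪ D)) (by
    intro v
    simp only [hEb, hEc, hQ', Finset.mem_union, Finset.mem_sdiff, Finset.mem_univ, true_and]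
    tauto)
  have cF := ee_cover F (A := TT) (B := Q') (E := Ec ∪ D) (by
    intro v
    simp only [hEc, hQ', Finset.mem_union, Finset.mem_sdiff, Finset.mem_univ, true_and]
    tauto)
  have g1 := ee_union_left_le G Eb (Ec ∪ D) Finset.univ
  have g2 := ee_union_left_le G Ec D Finset.univ
  have g3 := ee_union_left_le F Ec D Finset.univ
  have g4 := ee_self_le G T
  have g5 : ee F TT TT = 0 := ee_zero fun a ha b hb => c.no_F_TT ha hb
  refine final_arith (t := T.card) (q := Q'.card) (b := Eb.card) (c := Ec.card) (d := D.card)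
    hsum ?_ ?_ ?_ ?_ ?_ hDc hm ?_ ?_
  · have : (50000:ℝ) ≤ N := by rw [← hnN]; exact hpos
    exact_mod_cast this
  · rw [← hnN]; linarith
  · rw [← hnN]; linarith
  · rw [← hnN]; linarith
  · rw [← hnN]; linarith
  · rw [← hnN]; linarith
  · rw [← hnN]; linarith

end Conf
end conf


/-! ## Mantel-type lemmas for graphs with small codegrees -/

section mantel
variable {V : Type*}

lemma codeg_sum [DecidableEq V] {H : SimpleGraph V} {W : Finset V} {κ : ℝ}
    (hκ : ∀ a ∈ W, ∀ b ∈ W, H.Adj a b → dg H b (nb H a W) ≤ κ) {a b : V} (ha : a ∈ W) (hb : b ∈ W)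
    (hab : H.Adj a b) : dg H a W + dg H b W ≤ W.card + κ := by
  have h1 := card_inter_ge (nb_sub H a W) (nb_sub H b W)
  have h2 := hκ a ha b hb hab
  have h3 : nb H b (nb H a W) = nb H a W ∩ nb H b W := by
    ext z; simp only [mem_nb, Finset.mem_inter]; tauto
  rw [dg_eq_card, h3] at h2
  rw [dg_eq_card, dg_eq_card]
  linarith

lemma sum_deg_pairs (H : SimpleGraph V) (W : Finset V) :
    ∑ a ∈ W, ∑ b ∈ W, ad H a b * (dg H a W + dg H b W) = 2 * ∑ a ∈ W, (dg H a W) ^ 2 := by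
  have h1 : ∑ a ∈ W, ∑ b ∈ W, ad H a b * dg H a W = ∑ a ∈ W, (dg H a W) ^ 2 := by
    apply Finset.sum_congr rfl
    intro a _
    rw [← Finset.sum_mul, sq]; rfl
  have h2 : ∑ a ∈ W, ∑ b ∈ W, ad H a b * dg H b W = ∑ a ∈ W, (dg H a W) ^ 2 := by
    rw [Finset.sum_comm, ← h1]
    apply Finset.sum_congr rfl; intro a _
    apply Finset.sum_congr rfl; intro b _
    rw [ad_comm]
  simp_rw [mul_add, Finset.sum_add_distrib]
  rw [h1, h2]; ring

lemma cauchy_deg (H : SimpleGraph V) (W : Finset V) :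
    (ee H W W) ^ 2 ≤ W.card * ∑ a ∈ W, (dg H a W) ^ 2 := by
  unfold ee
  exact sq_sum_le_card_mul_sum_sq

lemma mantel [DecidableEq V] {H : SimpleGraph V} {W : Finset V} {κ : ℝ} (hκ0 : 0 ≤ κ)
    (hκ : ∀ a ∈ W, ∀ b ∈ W, H.Adj a b → dg H b (nb H a W) ≤ κ) :
    2 * ee H W W ≤ W.card * (W.card + κ) := by
  have h1 := sum_deg_pairs H W
  have h2 := cauchy_deg H W
  have h3 : ∑ a ∈ W, ∑ b ∈ W, ad H a b * (dg H a W + dg H b W) ≤ ee H W W * (W.card + κ) := by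
    unfold ee dg
    rw [Finset.sum_mul]
    apply Finset.sum_le_sum; intro a ha
    rw [Finset.sum_mul]
    apply Finset.sum_le_sum; intro b hb
    by_cases hab : H.Adj a b
    · rw [ad_of hab, one_mul, one_mul]
      exact codeg_sum hκ ha hb hab
    · rw [ad_not hab]; simp
  have h0 := ee_nonneg H W W
  have hw : (0:ℝ) ≤ W.card := Nat.cast_nonneg _
  set E := ee H W W
  rcases h0.eq_or_lt with h | h
  · have : (0:ℝ) ≤ W.card * (W.card + κ) := by positivity
    linarith
  · have : E * (2 * E) ≤ E * (W.card * (W.card + κ)) := by nlinarith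
    exact le_of_mul_le_mul_left this h

lemma near_bip [DecidableEq V] {H : SimpleGraph V} {W : Finset V} {κ : ℝ}
    (hκ : ∀ a ∈ W, ∀ b ∈ W, H.Adj a b → dg H b (nb H a W) ≤ κ) (hκ0 : 0 ≤ κ) (hE : 0 < ee H W W) :
    ∃ X ⊆ W, ∃ Y ⊆ W, Disjoint X Y ∧
      5 * ee H W W - 2 * (W.card : ℝ) ^ 2 - 6 * W.card * κ ≤ 2 * ee H X Y := by
  have h1 := sum_deg_pairs H W
  have h2 := cauchy_deg H W
  have hw0 : (0:ℝ) < W.card := by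
    rcases Nat.eq_zero_or_pos W.card with h | h
    · rw [Finset.card_eq_zero] at h
      subst h
      simp [ee] at hE
    · exact_mod_cast h
  set E := ee H W W with hEd
  have hex : ∃ a ∈ W, ∃ b ∈ W, H.Adj a b ∧ 2 * E ≤ W.card * (dg H a W + dg H b W) := by
    by_contra hno
    push Not at hno
    have hlt : ∑ a ∈ W, ∑ b ∈ W, ad H a b * (W.card * (dg H a W + dg H b W)) < E * (2 * E) := by
      have e : E * (2 * E) = ∑ a ∈ W, ∑ b ∈ W, ad H a b * (2 * E) := by
        simp_rw [← Finset.sum_mul]; rfl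
      rw [e]
      have hle : ∀ a ∈ W, ∀ b ∈ W, ad H a b * (W.card * (dg H a W + dg H b W)) ≤ ad H a b * (2 * E) := by
        intro a ha b hb
        by_cases hab : H.Adj a b
        · rw [ad_of hab, one_mul, one_mul]; exact (hno a ha b hb hab).le
        · rw [ad_not hab]; simp
      have hedge : ∃ a ∈ W, ∃ b ∈ W, H.Adj a b := by
        by_contra hn2
        push Not at hn2
        have := ee_zero hn2
        linarith
      obtain ⟨a, ha, b, hb, hab⟩ := hedge
      apply Finset.sum_lt_sum (fun a ha => Finset.sum_le_sum (hle a ha))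
      refine ⟨a, ha, Finset.sum_lt_sum (hle a ha) ⟨b, hb, ?_⟩⟩
      rw [ad_of hab, one_mul, one_mul]; exact hno a ha b hb hab
    have e2 : ∑ a ∈ W, ∑ b ∈ W, ad H a b * (W.card * (dg H a W + dg H b W)) =
        W.card * ∑ a ∈ W, ∑ b ∈ W, ad H a b * (dg H a W + dg H b W) := by
      simp_rw [Finset.mul_sum]
      apply Finset.sum_congr rfl; intro a _
      apply Finset.sum_congr rfl; intro b _
      ring
    rw [e2, h1] at hlt
    nlinarith
  obtain ⟨a, ha, b, hb, hab, hdeg⟩ := hex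
  set Na := nb H a W with hNa
  set Nb := nb H b W with hNb
  have hNas : Na ⊆ W := nb_sub _ _ _
  have hNbs : Nb ⊆ W := nb_sub _ _ _
  set X := Na \ Nb with hX
  set Y := Nb \ Na with hY
  have hXW : X ⊆ W := Finset.sdiff_subset.trans hNas
  have hYW : Y ⊆ W := Finset.sdiff_subset.trans hNbs
  have hdis : Disjoint X Y := by
    rw [Finset.disjoint_left]; intro z hz hz'
    rw [hX, Finset.mem_sdiff] at hz
    rw [hY, Finset.mem_sdiff] at hz'
    exact hz'.2 hz.1
  refine ⟨X, hXW, Y, hYW, hdis, ?_⟩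
  have hcod := hκ a ha b hb hab
  have h3 : nb H b Na = Na ∩ Nb := by
    ext z; simp only [hNa, hNb, mem_nb, Finset.mem_inter]; tauto
  rw [dg_eq_card, h3] at hcod
  have cX : (X.card : ℝ) = Na.card - (Na ∩ Nb).card := by
    have : X = Na \ (Na ∩ Nb) := by ext z; simp [hX]
    rw [this, card_sdiff_real Finset.inter_subset_left]
  have cY : (Y.card : ℝ) = Nb.card - (Na ∩ Nb).card := by
    have : Y = Nb \ (Na ∩ Nb) := by ext z; simp [hY]
    rw [this, card_sdiff_real Finset.inter_subset_right]
  rw [dg_eq_card, dg_eq_card] at hdeg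
  set Z := W \ (X ∪ Y) with hZ
  have hXYW : X ∪ Y ⊆ W := Finset.union_subset hXW hYW
  have cZ : (Z.card : ℝ) = W.card - (X.card + Y.card) := by
    rw [hZ, card_sdiff_real hXYW, Finset.card_union_of_disjoint hdis]; push_cast; ring
  -- edges inside the neighbourhoods
  have inn : ∀ c ∈ W, ee H (nb H c W) (nb H c W) ≤ W.card * κ := by
    intro c hc
    have : ee H (nb H c W) (nb H c W) ≤ (nb H c W).card * κ := ee_le_const fun z hz => by
      rw [mem_nb] at hz; exact hκ c hc z hz.1 hz.2
    have h5 : ((nb H c W).card : ℝ) ≤ W.card := by exact_mod_cast Finset.card_le_card (nb_sub _ _ _)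
    have h6 : ((nb H c W).card : ℝ) * κ ≤ W.card * κ := by gcongr
    linarith
  have iX : ee H X X ≤ W.card * κ :=
    (ee_mono H Finset.sdiff_subset Finset.sdiff_subset).trans (inn a ha)
  have iY : ee H Y Y ≤ W.card * κ :=
    (ee_mono H Finset.sdiff_subset Finset.sdiff_subset).trans (inn b hb)
  have hZe : ee H Z W ≤ Z.card * W.card := ee_le_mul _ _ _
  have htot : E ≤ ee H X X + ee H Y Y + 2 * ee H X Y + 2 * ee H Z W := by
    have hW : W = (X ∪ Y) ∪ Z := (Finset.union_sdiff_of_subset hXYW).symm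
    have t1 : E ≤ ee H (X ∪ Y) W + ee H Z W := by
      have := ee_union_left_le H (X ∪ Y) Z W
      rw [← hW] at this; exact this
    have t2 : ee H (X ∪ Y) W ≤ ee H (X ∪ Y) (X ∪ Y) + ee H (X ∪ Y) Z := by
      have := ee_union_right_le H (X ∪ Y) Z (X ∪ Y)
      rw [← hW] at this; exact this
    have t3 : ee H (X ∪ Y) Z ≤ ee H Z W := by
      rw [ee_comm]; exact ee_mono H (Finset.Subset.refl _) hXYW
    have t4 := ee_union_left_le H X Y (X ∪ Y)
    have t5 := ee_union_right_le H X Y X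
    have t6 := ee_union_right_le H X Y Y
    rw [ee_comm H Y X] at t6
    linarith
  have hz1 : (W.card : ℝ) * Z.card ≤ (W.card : ℝ) ^ 2 - 2 * E + 2 * W.card * κ := by
    rw [cZ, cX, cY]
    nlinarith
  nlinarith

end mantel

/-! ## Passing to minimum degree, alternating paths -/

section mindeg
variable {V : Type*} [DecidableEq V]

lemma min_deg_pair (G : SimpleGraph V) (K : ℝ) (hK : 0 ≤ K) : ∀ (N : ℕ) (D S : Finset V), D.card + S.card = N →
    K * (D.card + S.card) < ee G D S → ∃ D1 ⊆ D, ∃ S1 ⊆ S, D1.Nonempty ∧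
      (∀ d ∈ D1, K < dg G d S1) ∧ (∀ s ∈ S1, K < dg G s D1) := by
  intro N
  induction N with
  | zero =>
    intro D S hN h
    have hD : D = ∅ := by rw [← Finset.card_eq_zero]; omega
    have hS : S = ∅ := by rw [← Finset.card_eq_zero]; omega
    subst hD hS
    simp [ee] at h
  | succ N ih =>
    intro D S hN h
    by_cases h1 : ∃ d ∈ D, dg G d S ≤ K
    · obtain ⟨d, hd, hdS⟩ := h1
      have hc : (D.erase d).card + 1 = D.card := Finset.card_erase_add_one hd
      have e : ee G D S = dg G d S + ee G (D.erase d) S := (Finset.add_sum_erase D _ hd).symm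
      have hcr : ((D.erase d).card : ℝ) + 1 = D.card := by exact_mod_cast hc
      obtain ⟨D1, h1, S1, h2, h3⟩ := ih (D.erase d) S (by omega) (by
        have : K * ((D.erase d).card + S.card) = K * (D.card + S.card) - K := by rw [← hcr]; ring
        linarith)
      exact ⟨D1, h1.trans (Finset.erase_subset _ _), S1, h2, h3⟩
    by_cases h2 : ∃ s ∈ S, dg G s D ≤ K
    · obtain ⟨d, hd, hdS⟩ := h2
      have hc : (S.erase d).card + 1 = S.card := Finset.card_erase_add_one hd
      have e : ee G S D = dg G d D + ee G (S.erase d) D := (Finset.add_sum_erase S _ hd).symm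
      rw [ee_comm G S D, ee_comm G (S.erase d) D] at e
      have hcr : ((S.erase d).card : ℝ) + 1 = S.card := by exact_mod_cast hc
      obtain ⟨D1, h1, S1, h2, h3⟩ := ih D (S.erase d) (by omega) (by
        have : K * (D.card + (S.erase d).card) = K * (D.card + S.card) - K := by rw [← hcr]; ring
        linarith)
      exact ⟨D1, h1, S1, h2.trans (Finset.erase_subset _ _), h3⟩
    push Not at h1 h2
    refine ⟨D, Finset.Subset.refl _, S, Finset.Subset.refl _, ?_, h1, h2⟩
    rw [Finset.nonempty_iff_ne_empty]
    rintro rfl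
    have hS : S.Nonempty := by
      rw [← Finset.card_pos]; simp at hN; omega
    obtain ⟨s, hs⟩ := hS
    have h3 := h2 s hs
    simp [dg] at h3
    linarith

lemma alt_path {G : SimpleGraph V} {D S : Finset V} {K : ℕ} (hD : ∀ d ∈ D, (K : ℝ) < dg G d S)
    (hS : ∀ s ∈ S, (K : ℝ) < dg G s D) : ∀ (j : ℕ) (d : V) (X : Finset V), d ∈ D → d ∉ X →
      X.card + 2 * j + 2 ≤ K → ∃ s ∈ S, ∃ U, PS G (2 * j + 1) d s U ∧ Disjoint U X := by
  intro j
  induction j with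
  | zero =>
    intro d X hd hdX hK
    obtain ⟨s, hs, hds, hsX⟩ := pick_nb (H := G) (v := d) (B := S) (X := X)
      (lt_of_le_of_lt (by exact_mod_cast (by omega : X.card ≤ K)) (hD d hd))
    refine ⟨s, hs, {d, s}, PS.edge hds, ?_⟩
    rw [Finset.disjoint_left]; intro a ha
    simp only [Finset.mem_insert, Finset.mem_singleton] at ha
    rcases ha with rfl | rfl <;> assumption
  | succ j ih =>
    intro d X hd hdX hK
    obtain ⟨s, hs, hds, hsX⟩ := pick_nb (H := G) (v := d) (B := S) (X := X)
      (lt_of_le_of_lt (by exact_mod_cast (by omega : X.card ≤ K)) (hD d hd))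
    have c1 := Finset.card_insert_le s X
    have c2 := Finset.card_insert_le d (insert s X)
    obtain ⟨d', hd', hsd', hd'X⟩ := pick_nb (H := G) (v := s) (B := D) (X := insert d (insert s X))
      (lt_of_le_of_lt (by exact_mod_cast (by omega : (insert d (insert s X)).card ≤ K)) (hS s hs))
    obtain ⟨s', hs', U, hU, hdis⟩ := ih d' (insert d (insert s X)) hd' hd'X (by omega)
    rw [Finset.disjoint_right] at hdis
    refine ⟨s', hs', _, (PS.cons hds (PS.cons hsd' hU (hdis (by simp))) ?_).cast (by ring), ?_⟩
    · simp only [Finset.mem_insert, not_or]; exact ⟨hds.ne, hdis (by simp)⟩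
    · rw [Finset.disjoint_right]; intro a ha
      simp only [Finset.mem_insert, not_or]
      exact ⟨fun h => hdX (h ▸ ha), fun h => hsX (h ▸ ha), hdis (by simp [ha])⟩

/-- The structure found by averaging yields a cycle through an F-edge. -/
lemma rich_contra {G F : SimpleGraph V} {k : ℕ} (hk : 3 ≤ k) (hFG : F ≤ G)
    (hF : ∀ u v S, F.Adj u v → PS G (2 * k) u v S → False)
    {v x y : V} {D S : Finset V} (hxy : G.Adj x y) (hD : ∀ d ∈ D, F.Adj v d)
    (hS : ∀ s ∈ S, G.Adj s x ∧ G.Adj s y) (hx : x ∉ D) (hy : y ∉ D) (hvS : v ∉ S)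
    (hvx : v ≠ x) (hvy : v ≠ y)
    (he : ((2 * k + 20 : ℕ) : ℝ) * (D.card + S.card) < ee G D S) : False := by
  obtain ⟨D1, hD1, S1, hS1, ⟨d1, hd1⟩, hdD, hdS⟩ := min_deg_pair G ((2 * k + 20 : ℕ) : ℝ) (Nat.cast_nonneg _) _ D S rfl he
  have c3 : ({v, x, y} : Finset V).card ≤ 3 := Finset.card_le_three
  obtain ⟨s, hs, U, hU, hdis⟩ := alt_path (K := 2 * k + 20) hdD hdS (k - 3) d1 {v, x, y} hd1
    (by simp only [Finset.mem_insert, Finset.mem_singleton, not_or]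
        exact ⟨(hD d1 (hD1 hd1)).ne', fun h => hx (h ▸ hD1 hd1), fun h => hy (h ▸ hD1 hd1)⟩)
    (by omega)
  rw [Finset.disjoint_right] at hdis
  have hvU : v ∉ U := hdis (by simp)
  have hxU : x ∉ U := hdis (by simp)
  have hyU : y ∉ U := hdis (by simp)
  have cU := hU.card
  have cU1 := Finset.card_insert_le x U
  have cU2 := Finset.card_insert_le y (insert x U)
  -- the second vertex of S
  have hS1c : ((2 * k + 20 : ℕ) : ℝ) < S1.card := (hdD d1 hd1).trans_le (dg_le_card _ _ _)
  have hS1c' : (insert y (insert x U)).card < S1.card := by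
    have : 2 * k + 20 < S1.card := by exact_mod_cast hS1c
    omega
  obtain ⟨s', hs', hs'U⟩ := Finset.exists_mem_notMem_of_card_lt_card hS1c'
  have cU3 := Finset.card_insert_le s' (insert y (insert x U))
  obtain ⟨d', hd', hsd', hd'U⟩ := pick_nb (H := G) (v := s') (B := D1)
    (X := insert s' (insert y (insert x U)))
    (lt_of_le_of_lt (by exact_mod_cast (by omega)) (hdS s' hs'))
  have a1 := (hS s (hS1 hs)).1
  have a2 := (hS s' (hS1 hs')).2
  have p1 := hU.snoc a1 hxU
  have p2 := p1.snoc hxy (by simp only [Finset.mem_insert, not_or]; exact ⟨hxy.ne', hyU⟩)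
  have p3 := p2.snoc a2.symm hs'U
  have p4 := p3.snoc hsd' hd'U
  have p5 := p4.snoc (hFG (hD d' (hD1 hd'))).symm (by
    simp only [Finset.mem_insert, not_or]
    exact ⟨(hD d' (hD1 hd')).ne, fun h => hvS (h ▸ hS1 hs'), hvy, hvx, hvU⟩)
  exact hF _ _ _ (hD d1 (hD1 hd1)).symm (p5.cast (by omega))

end mindeg


section rich
variable {V : Type*} [DecidableEq V] [Fintype V]

lemma ee_nb_eq (G : SimpleGraph V) (s : V) (U : Finset V) :
    ee G (nb G s U) (nb G s U) = ∑ x ∈ U, ∑ y ∈ U, ad G x y * (ad G s x * ad G s y) := by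
  unfold ee dg nb
  rw [sum_ite_fs]
  apply Finset.sum_congr rfl; intro x _
  rw [sum_ite_fs]
  by_cases hx : G.Adj s x
  · simp only [hx, if_true]
    apply Finset.sum_congr rfl; intro y _
    by_cases hy : G.Adj s y
    · simp [hy, ad_of hx, ad_of hy]
    · simp [hy, ad_not hy]
  · simp [hx, ad_not hx]

lemma rich_avg {G F : SimpleGraph V} {k : ℕ} {n b1 b2 b3 : ℝ} (hk : 3 ≤ k) (hFG : F ≤ G)
    (hV : (Fintype.card V : ℝ) = n)
    (hF : ∀ u v S, F.Adj u v → PS G (2 * k) u v S → False)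
    {v : V} {D R U : Finset V} (hD : ∀ d ∈ D, F.Adj v d) (hvU : v ∉ U) (hvR : v ∉ R)
    (hb1 : 0 ≤ b1) (hb2 : 0 ≤ b2)
    (h1 : ∀ s ∈ R, b1 ≤ ee G (nb G s U) (nb G s U)) (h2 : ∀ d ∈ D, b2 ≤ dg G d R)
    (h3 : b3 ≤ D.card) (hbig : (4 * k + 43) * n ^ 3 < b1 * b2 * b3) : False := by
  have hn0 : (0:ℝ) ≤ n := by rw [← hV]; positivity
  have hcard : ∀ A : Finset V, (A.card : ℝ) ≤ n := fun A => by
    rw [← hV]; exact_mod_cast Finset.card_le_univ A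
  have e1 : b2 * b3 ≤ ee G R D := by
    rw [ee_comm]
    refine le_trans ?_ (le_ee_const h2)
    nlinarith
  have e2 : b1 * b2 * b3 ≤ ∑ s ∈ R, dg G s D * ee G (nb G s U) (nb G s U) := by
    calc b1 * b2 * b3 ≤ b1 * ee G R D := by nlinarith
      _ = ∑ s ∈ R, dg G s D * b1 := by unfold ee; rw [Finset.mul_sum]; simp_rw [mul_comm]
      _ ≤ _ := Finset.sum_le_sum fun s hs => mul_le_mul_of_nonneg_left (h1 s hs) (dg_nonneg _ _ _)
  have e3 : ∑ s ∈ R, dg G s D * ee G (nb G s U) (nb G s U)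
      = ∑ x ∈ U, ∑ y ∈ U, ad G x y * ∑ s ∈ R, dg G s D * (ad G s x * ad G s y) := by
    simp_rw [ee_nb_eq, Finset.mul_sum]
    rw [Finset.sum_comm]
    apply Finset.sum_congr rfl; intro x _
    rw [Finset.sum_comm]
    apply Finset.sum_congr rfl; intro y _
    apply Finset.sum_congr rfl; intro s _
    ring
  have key : ∃ x ∈ U, ∃ y ∈ U, G.Adj x y ∧
      (4 * k + 43) * n < ∑ s ∈ R, dg G s D * (ad G s x * ad G s y) := by
    by_contra hcon
    push Not at hcon
    have hc0 : (0:ℝ) ≤ (4 * k + 43) * n := by positivity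
    have : ∑ x ∈ U, ∑ y ∈ U, ad G x y * ∑ s ∈ R, dg G s D * (ad G s x * ad G s y)
        ≤ ∑ x ∈ U, ∑ y ∈ U, (4 * k + 43) * n := by
      apply Finset.sum_le_sum; intro x hx
      apply Finset.sum_le_sum; intro y hy
      by_cases hxy : G.Adj x y
      · rw [ad_of hxy, one_mul]; exact hcon x hx y hy hxy
      · rw [ad_not hxy, zero_mul]; exact hc0
    simp only [Finset.sum_const, nsmul_eq_mul] at this
    have hU := hcard U
    have hU0 : (0:ℝ) ≤ U.card := Nat.cast_nonneg _
    have h5 : (U.card:ℝ) * (U.card * ((4 * k + 43) * n)) ≤ n * (n * ((4 * k + 43) * n)) := by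
      gcongr
    nlinarith
  obtain ⟨x, hx, y, hy, hxy, hg⟩ := key
  set S := fs R (fun s => G.Adj s x ∧ G.Adj s y) with hS
  have g1 : ∑ s ∈ R, dg G s D * (ad G s x * ad G s y) = ee G D S := by
    rw [ee_comm, hS]; unfold ee
    rw [sum_ite_fs]
    apply Finset.sum_congr rfl; intro s _
    by_cases h1 : G.Adj s x
    · by_cases h2 : G.Adj s y
      · simp [h1, h2, ad_of h1, ad_of h2]
      · simp [h2, ad_not h2]
    · simp [h1, ad_not h1]
  rw [g1] at hg
  have g2 : ee G D S ≤ ee G (D \ {x, y}) S + ee G {x, y} S := by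
    refine le_trans (ee_mono G (A' := (D \ {x, y}) ∪ {x, y}) ?_ (Finset.Subset.refl _)) (ee_union_left_le _ _ _ _)
    intro a ha
    by_cases h : a ∈ ({x, y} : Finset V)
    · exact Finset.mem_union_right _ h
    · exact Finset.mem_union_left _ (Finset.mem_sdiff.2 ⟨ha, h⟩)
  have g3 : ee G {x, y} S ≤ 2 * n := by
    refine (ee_le_mul _ _ _).trans ?_
    have : (({x, y} : Finset V).card : ℝ) ≤ 2 := by exact_mod_cast Finset.card_le_two
    have := hcard S
    have : (0:ℝ) ≤ S.card := Nat.cast_nonneg _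
    nlinarith
  refine rich_contra hk hFG hF (v := v) (x := x) (y := y) (D := D \ {x, y}) (S := S) hxy
    (fun d hd => hD d (Finset.mem_sdiff.1 hd).1) (fun s hs => by rw [hS, mem_fs] at hs; exact hs.2) (by simp) (by simp)
    (fun h => hvR (fs_sub _ _ h)) (fun h => hvU (h ▸ hx)) (fun h => hvU (h ▸ hy)) ?_
  have q1 := hcard (D \ {x, y})
  have q2 := hcard S
  have : ((2 * k + 20 : ℕ) : ℝ) * ((D \ {x, y}).card + S.card) ≤ ((2 * k + 20 : ℕ) : ℝ) * (n + n) := by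
    gcongr
  push_cast at this ⊢
  nlinarith


lemma ind_sum (B : Finset V) (p : V → Prop) :
    ∑ b ∈ B, (@ite ℝ (p b) (Classical.propDecidable _) 1 0) = ((fs B p).card : ℝ) := by
  rw [← sum_ite_fs]; simp

lemma cleaning {G F : SimpleGraph V} {k : ℕ} {n ε : ℝ} (hk : 3 ≤ k) (hFG : F ≤ G)
    (hV : (Fintype.card V : ℝ) = n)
    (hF : ∀ u v S, F.Adj u v → PS G (2 * k) u v S → False)
    (hε : 0 < ε) (hε1 : ε ≤ 1 / 2) (hn : 16 * k + 173 ≤ ε ^ 6 * n) :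
    ∃ (H F2 : SimpleGraph V) (R : Finset V), H ≤ G ∧ F2 ≤ H ∧ F2 ≤ F ∧
      ee G .univ .univ - 4 * ε * n ^ 2 ≤ ee H .univ .univ ∧
      ee F .univ .univ - 6 * ε * n ^ 2 ≤ ee F2 .univ .univ ∧
      (∀ x y, H.Adj x y → x ∉ R → dg G y (nb G x .univ) ≤ ε * n) ∧
      (∀ s, s ∉ R → ee G (nb G s .univ) (nb G s .univ) ≤ ε ^ 2 * n ^ 2) ∧
      (∀ v w, F2.Adj v w → v ∉ R ∧ dg G v R < ε ^ 2 * n ∧ ∀ r ∈ R, ¬ H.Adj v r) := by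
  have hn0 : (0:ℝ) ≤ n := by rw [← hV]; positivity
  have hcard : ∀ A : Finset V, (A.card : ℝ) ≤ n := fun A => by
    rw [← hV]; exact_mod_cast Finset.card_le_univ A
  have hk0 : (0:ℝ) ≤ k := Nat.cast_nonneg _
  have hnpos : 0 < n := by
    rcases hn0.eq_or_lt with h | h
    · rw [← h] at hn; linarith
    · exact h
  have he2 : ε ^ 2 ≤ ε := by nlinarith
  have he6 : ε ^ 6 ≤ ε ^ 2 := pow_le_pow_of_le_one hε.le (by linarith) (by norm_num)
  have hbn : 4 ≤ ε ^ 2 * n := by nlinarith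
  set R := fs (Finset.univ : Finset V)
    (fun s => ε ^ 2 * n ^ 2 ≤ ee G (nb G s .univ) (nb G s .univ)) with hR
  set P := fs (Finset.univ : Finset V) (fun q => ε ^ 2 * n ≤ dg G q R) with hP
  have hFP : ∀ v, dg F v P ≤ ε ^ 2 * n := by
    intro v
    by_contra hcon
    push Not at hcon
    refine rich_avg (G := G) (F := F) (n := n) (b1 := ε ^ 2 * n ^ 2 / 2) (b2 := ε ^ 2 * n / 2)
      (b3 := ε ^ 2 * n) hk hFG hV hF (v := v) (D := nb F v P) (R := R \ {v}) (U := .univ \ {v})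
      (fun d hd => (mem_nb.1 hd).2) (by simp) (by simp) (by positivity) (by positivity) ?_ ?_ ?_ ?_
    · intro s hs
      have h1 : s ∈ R := (Finset.mem_sdiff.1 hs).1
      rw [hR, mem_fs] at h1
      have h2 := h1.2
      have h3 : nb G s .univ ⊆ nb G s (.univ \ {v}) ∪ {v} := by
        intro a ha
        rw [mem_nb] at ha
        by_cases h : a = v
        · simp [h]
        · simp [h, ha.2]
      have h4 := ee_mono G h3 h3
      have h5 := ee_union_left_le G (nb G s (.univ \ {v})) {v} (nb G s (.univ \ {v}) ∪ {v})
      have h6 := ee_union_right_le G (nb G s (.univ \ {v})) {v} (nb G s (.univ \ {v}))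
      have h7 := ee_le_mul G {v} (nb G s (.univ \ {v}) ∪ {v})
      have h8 := ee_le_mul G (nb G s (.univ \ {v})) {v}
      have h9 := hcard (nb G s (.univ \ {v}))
      have h10 := hcard (nb G s (.univ \ {v}) ∪ {v})
      simp only [Finset.card_singleton, Nat.cast_one, one_mul, mul_one] at h7 h8
      nlinarith
    · intro d hd
      have h1 : d ∈ P := (mem_nb.1 hd).1
      rw [hP, mem_fs] at h1
      have h2 := h1.2
      have h3 : R ⊆ (R \ {v}) ∪ {v} := by
        intro a ha
        by_cases h : a = v
        · simp [h]
        · simp [h, ha]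
      have h4 := dg_mono G d h3
      have h5 := dg_union_le G d (R \ {v}) {v}
      have h6 := dg_le_card G d {v}
      simp only [Finset.card_singleton, Nat.cast_one] at h6
      linarith
    · rw [← dg_eq_card]; exact hcon.le
    · have : (16 * k + 173) * n ^ 3 ≤ ε ^ 6 * n * n ^ 3 := by gcongr
      have h3 : 0 < n ^ 3 := by positivity
      nlinarith
  -- the graphs
  set bad : V → V → Prop := fun x y =>
    (x ∉ P ∧ y ∈ R) ∨ (x ∉ R ∧ ε * n < dg G y (nb G x .univ)) with hbad
  let H : SimpleGraph V :=
    { Adj := fun x y => G.Adj x y ∧ ¬ bad x y ∧ ¬ bad y x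
      symm := ⟨fun x y h => ⟨h.1.symm, h.2.2, h.2.1⟩⟩
      loopless := ⟨fun x h => h.1.ne rfl⟩ }
  let F2 : SimpleGraph V :=
    { Adj := fun x y => F.Adj x y ∧ H.Adj x y ∧ x ∉ P ∧ y ∉ P
      symm := ⟨fun x y h => ⟨h.1.symm, h.2.1.symm, h.2.2.2, h.2.2.1⟩⟩
      loopless := ⟨fun x h => h.1.ne rfl⟩ }
  have hHadj : ∀ x y, H.Adj x y ↔ G.Adj x y ∧ ¬ bad x y ∧ ¬ bad y x := fun _ _ => Iff.rfl
  have hF2adj : ∀ x y, F2.Adj x y ↔ F.Adj x y ∧ H.Adj x y ∧ x ∉ P ∧ y ∉ P := fun _ _ => Iff.rfl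
  clear_value H F2
  set b : V → V → ℝ := fun x y => @ite ℝ (G.Adj x y ∧ bad x y) (Classical.propDecidable _) 1 0 with hb
  have hb0 : ∀ x y, 0 ≤ b x y := fun x y => by rw [hb]; dsimp only; split_ifs <;> norm_num
  have hnR : ∀ s, s ∉ R → ee G (nb G s .univ) (nb G s .univ) ≤ ε ^ 2 * n ^ 2 := by
    intro s hs
    rw [hR, mem_fs] at hs
    push Not at hs
    exact (hs (Finset.mem_univ _)).le
  have hnP : ∀ s, s ∉ P → dg G s R < ε ^ 2 * n := by
    intro s hs
    rw [hP, mem_fs] at hs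
    push Not at hs
    exact hs (Finset.mem_univ _)
  have hbsum : ∀ x, ∑ y, b x y ≤ 2 * ε * n := by
    intro x
    rw [hb]; dsimp only
    rw [ind_sum]
    have h1 : fs (Finset.univ : Finset V) (fun y => G.Adj x y ∧ bad x y) ⊆
        fs .univ (fun y => x ∉ P ∧ y ∈ nb G x R) ∪
        fs .univ (fun y => x ∉ R ∧ y ∈ fs (nb G x .univ) (fun y => ε * n < dg G y (nb G x .univ))) := by
      intro y hy
      rw [mem_fs] at hy
      simp only [Finset.mem_union, mem_fs, mem_nb, Finset.mem_univ, true_and]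
      rcases hy.2.2 with h | h
      · left; exact ⟨h.1, h.2, hy.2.1⟩
      · right; exact ⟨h.1, hy.2.1, h.2⟩
    have h2 : ((fs (Finset.univ : Finset V) (fun y => x ∉ P ∧ y ∈ nb G x R)).card : ℝ) ≤ ε * n := by
      by_cases hx : x ∈ P
      · have : fs (Finset.univ : Finset V) (fun y => x ∉ P ∧ y ∈ nb G x R) = ∅ := by
          ext y; simp [hx]
        rw [this]; simp; positivity
      · have : fs (Finset.univ : Finset V) (fun y => x ∉ P ∧ y ∈ nb G x R) = nb G x R := by
          ext y; simp [hx]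
        rw [this, ← dg_eq_card]
        have := hnP x hx
        nlinarith
    have h3 : ((fs (Finset.univ : Finset V) (fun y => x ∉ R ∧
        y ∈ fs (nb G x .univ) (fun y => ε * n < dg G y (nb G x .univ)))).card : ℝ) ≤ ε * n := by
      by_cases hx : x ∈ R
      · have : fs (Finset.univ : Finset V) (fun y => x ∉ R ∧
          y ∈ fs (nb G x .univ) (fun y => ε * n < dg G y (nb G x .univ))) = ∅ := by
          ext y; simp [hx]
        rw [this]; simp; positivity
      · set Z := fs (nb G x .univ) (fun y => ε * n < dg G y (nb G x .univ)) with hZ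
        have : fs (Finset.univ : Finset V) (fun y => x ∉ R ∧ y ∈ Z) = Z := by
          ext y; simp [hx]
        rw [this]
        have h4 := le_ee_const (H := G) (A := Z) (B := nb G x .univ) (c := ε * n)
          (fun a ha => by rw [hZ, mem_fs] at ha; exact ha.2.le)
        have h5 := ee_mono G (fs_sub _ _ : Z ⊆ nb G x .univ) (Finset.Subset.refl (nb G x .univ))
        have h6 := hnR x hx
        have h7 : (Z.card : ℝ) * (ε * n) ≤ (ε * n) * (ε * n) := by nlinarith
        exact le_of_mul_le_mul_right h7 (by positivity)
    have h4 := Finset.card_le_card h1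
    have h5 := h4.trans (Finset.card_union_le _ _)
    have h6 := (Nat.cast_le (α := ℝ)).2 h5
    push_cast at h6
    linarith
  have hbt : ∑ x, ∑ y, b x y ≤ 2 * ε * n ^ 2 := by
    calc ∑ x, ∑ y, b x y ≤ ∑ x : V, 2 * ε * n := Finset.sum_le_sum fun x _ => hbsum x
      _ = 2 * ε * n ^ 2 := by
        simp only [Finset.sum_const, nsmul_eq_mul, Finset.card_univ, hV]; ring
  have hbt' : ∑ x, ∑ y, b y x ≤ 2 * ε * n ^ 2 := by rw [Finset.sum_comm]; exact hbt
  have hGH : ∀ x y, ad G x y ≤ ad H x y + b x y + b y x := by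
    intro x y
    by_cases h : G.Adj x y
    · rw [ad_of h]
      have q1 := hb0 x y
      have q2 := hb0 y x
      by_cases h1 : bad x y
      · have : b x y = 1 := by rw [hb]; simp [h, h1]
        linarith [ad_nonneg H x y]
      by_cases h2 : bad y x
      · have : b y x = 1 := by rw [hb]; simp [h.symm, h2]
        linarith [ad_nonneg H x y]
      · rw [ad_of ((hHadj x y).2 ⟨h, h1, h2⟩)]; linarith
    · rw [ad_not h]; linarith [ad_nonneg H x y, hb0 x y, hb0 y x]
  have hFG2 : ∀ x y, ad F x y ≤ ad F2 x y + b x y + b y x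
      + @ite ℝ (x ∈ P) (Classical.propDecidable _) (ad F x y) 0
      + @ite ℝ (y ∈ P) (Classical.propDecidable _) (ad F x y) 0 := by
    intro x y
    have q1 := hb0 x y
    have q2 := hb0 y x
    have q3 := ad_nonneg F x y
    have q4 := ad_nonneg F2 x y
    by_cases h : F.Adj x y
    · by_cases h1 : x ∈ P
      · rw [if_pos h1]; split_ifs <;> linarith
      by_cases h2 : y ∈ P
      · rw [if_pos h2, if_neg h1]; linarith
      rw [if_neg h1, if_neg h2, ad_of h]
      by_cases h3 : H.Adj x y
      · rw [ad_of ((hF2adj x y).2 ⟨h, h3, h1, h2⟩)]; linarith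
      · have := hGH x y
        rw [ad_of (hFG h), ad_not h3] at this
        linarith
    · rw [ad_not h]; simp; linarith
  refine ⟨H, F2, R, fun x y h => ((hHadj x y).1 h).1, fun x y h => ((hF2adj x y).1 h).2.1,
    fun x y h => ((hF2adj x y).1 h).1, ?_, ?_, ?_, hnR, ?_⟩
  · have : ee G .univ .univ ≤ ee H .univ .univ + ∑ x, ∑ y, b x y + ∑ x, ∑ y, b y x := by
      unfold ee dg
      rw [← Finset.sum_add_distrib, ← Finset.sum_add_distrib]
      apply Finset.sum_le_sum; intro x _
      rw [← Finset.sum_add_distrib, ← Finset.sum_add_distrib]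
      exact Finset.sum_le_sum fun y _ => hGH x y
    linarith
  · have hP1 : ee F .univ P ≤ n * (ε ^ 2 * n) := by
      rw [← hV, ← Finset.card_univ]
      have := ee_le_const (H := F) (A := Finset.univ) (B := P) (fun a _ => hFP a)
      rw [← hV, ← Finset.card_univ] at this
      exact this
    have r1 : ∑ x, ∑ y, @ite ℝ (y ∈ P) (Classical.propDecidable _) (ad F x y) 0 = ee F .univ P := by
      unfold ee dg
      apply Finset.sum_congr rfl; intro x _
      rw [← sum_ite_fs]
      congr 1; ext y; simp
    have r2 : ∑ x, ∑ y, @ite ℝ (x ∈ P) (Classical.propDecidable _) (ad F x y) 0 = ee F .univ P := by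
      rw [← r1, Finset.sum_comm]
      apply Finset.sum_congr rfl; intro x _
      apply Finset.sum_congr rfl; intro y _
      rw [ad_comm F]
    have : ee F .univ .univ ≤ ee F2 .univ .univ + ∑ x, ∑ y, b x y + ∑ x, ∑ y, b y x
        + ∑ x, ∑ y, @ite ℝ (x ∈ P) (Classical.propDecidable _) (ad F x y) 0
        + ∑ x, ∑ y, @ite ℝ (y ∈ P) (Classical.propDecidable _) (ad F x y) 0 := by
      unfold ee dg
      simp only [← Finset.sum_add_distrib]
      apply Finset.sum_le_sum; intro x _
      exact Finset.sum_le_sum fun y _ => hFG2 x y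
    rw [r1, r2] at this
    have h5 : ε ^ 2 * n ^ 2 ≤ ε / 2 * n ^ 2 := by
      apply mul_le_mul_of_nonneg_right _ (by positivity); nlinarith
    nlinarith
  · intro x y h hx
    have := ((hHadj x y).1 h).2.1
    rw [hbad] at this
    push Not at this
    exact this.2 hx
  · intro v w h
    rw [hF2adj, hHadj] at h
    obtain ⟨h1, ⟨h2, h3, h4⟩, h5, h6⟩ := h
    refine ⟨fun h => h4 (Or.inl ⟨h6, h⟩), hnP v h5, fun r hr h => ?_⟩
    rw [hHadj] at h
    exact h.2.1 (Or.inl ⟨h5, hr⟩)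

end rich


section step2
variable {V : Type*} [DecidableEq V] [Fintype V]

lemma exists_max_matching (H : SimpleGraph V) (S R : Finset V) : ∃ M : Finset (V × V),
    (∀ p ∈ M, p.1 ∈ S ∧ p.2 ∈ R ∧ H.Adj p.1 p.2) ∧
    (∀ p ∈ M, ∀ q ∈ M, p.1 = q.1 → p = q) ∧ (∀ p ∈ M, ∀ q ∈ M, p.2 = q.2 → p = q) ∧
    (∀ s ∈ S, ∀ r ∈ R, s ∉ M.image Prod.fst → r ∉ M.image Prod.snd → ¬ H.Adj s r) := by
  classical
  let P : Finset (V × V) → Prop := fun M => (∀ p ∈ M, p.1 ∈ S ∧ p.2 ∈ R ∧ H.Adj p.1 p.2) ∧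
    (∀ p ∈ M, ∀ q ∈ M, p.1 = q.1 → p = q) ∧ (∀ p ∈ M, ∀ q ∈ M, p.2 = q.2 → p = q)
  obtain ⟨M, hM, hmax⟩ := Finset.exists_max_image (Finset.univ.filter P) Finset.card
    ⟨∅, by simp [P]⟩
  have hP : P M := (Finset.mem_filter.1 hM).2
  refine ⟨M, hP.1, hP.2.1, hP.2.2, ?_⟩
  intro s hs r hr hsM hrM hsr
  have h1 : ∀ q ∈ M, q.1 ≠ s := fun q hq h => hsM (Finset.mem_image.2 ⟨q, hq, h⟩)
  have h2 : ∀ q ∈ M, q.2 ≠ r := fun q hq h => hrM (Finset.mem_image.2 ⟨q, hq, h⟩)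
  have hn : (s, r) ∉ M := fun h => h1 _ h rfl
  have hP' : P (insert (s, r) M) := by
    refine ⟨?_, ?_, ?_⟩
    · intro p hp
      rcases Finset.mem_insert.1 hp with rfl | hp
      · exact ⟨hs, hr, hsr⟩
      · exact hP.1 p hp
    · intro p hp q hq h
      rcases Finset.mem_insert.1 hp with rfl | hp <;> rcases Finset.mem_insert.1 hq with rfl | hq
      · rfl
      · exact absurd h.symm (h1 q hq)
      · exact absurd h (h1 p hp)
      · exact hP.2.1 p hp q hq h
    · intro p hp q hq h
      rcases Finset.mem_insert.1 hp with rfl | hp <;> rcases Finset.mem_insert.1 hq with rfl | hq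
      · rfl
      · exact absurd h.symm (h2 q hq)
      · exact absurd h (h2 p hp)
      · exact hP.2.2 p hp q hq h
  have := hmax _ (Finset.mem_filter.2 ⟨Finset.mem_univ _, hP'⟩)
  rw [Finset.card_insert_of_notMem hn] at this
  omega

lemma pair_bound {H G : SimpleGraph V} (hHG : H ≤ G) {s r : V} {κ : ℝ} {B E : Finset V}
    (hc : dg G r (nb G s .univ) ≤ κ) (hE : E ⊆ B) (hEs : ∀ x ∈ E, ¬ H.Adj s x)
    (hEr : ∀ x ∈ E, ¬ H.Adj r x) : dg H s B + dg H r B ≤ B.card - E.card + κ := by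
  have h1 := Finset.card_union_add_card_inter (nb H s B) (nb H r B)
  have h2 : nb H s B ∪ nb H r B ⊆ B \ E := by
    intro x hx
    rw [Finset.mem_sdiff]
    rcases Finset.mem_union.1 hx with h | h
    · rw [mem_nb] at h; exact ⟨h.1, fun h' => hEs x h' h.2⟩
    · rw [mem_nb] at h; exact ⟨h.1, fun h' => hEr x h' h.2⟩
  have h3 : nb H s B ∩ nb H r B ⊆ nb G r (nb G s .univ) := by
    intro x hx
    simp only [Finset.mem_inter, mem_nb] at hx
    simp only [mem_nb, Finset.mem_univ, true_and]
    exact ⟨hHG hx.1.2, hHG hx.2.2⟩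
  have h4 := (Nat.cast_le (α := ℝ)).2 (Finset.card_le_card h2)
  have h5 := (Nat.cast_le (α := ℝ)).2 (Finset.card_le_card h3)
  have h6 := card_sdiff_real hE
  rw [dg_eq_card] at hc
  rw [dg_eq_card, dg_eq_card]
  have h7 : ((nb H s B ∪ nb H r B).card : ℝ) + (nb H s B ∩ nb H r B).card
    = (nb H s B).card + (nb H r B).card := by exact_mod_cast h1
  linarith

/-- Everything that we know after cleaning. -/
structure Cleaned (G F H F2 : SimpleGraph V) (R : Finset V) (k : ℕ) (n ε : ℝ) : Prop where
  hk : 3 ≤ k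
  hV : (Fintype.card V : ℝ) = n
  hn : 1000 * (4 * k + 40) ≤ n
  hFG : F ≤ G
  hF : ∀ u v S, F.Adj u v → PS G (2 * k) u v S → False
  hHG : H ≤ G
  hF2H : F2 ≤ H
  hF2F : F2 ≤ F
  e0 : 0 < ε
  e1 : ε ≤ 1 / 10 ^ 16
  eH : n ^ 2 / 2 - 4 * ε * n ^ 2 ≤ ee H .univ .univ
  eF : n ^ 2 / 18 - 7 * ε * n ^ 2 ≤ ee F2 .univ .univ
  cod : ∀ x y, H.Adj x y → x ∉ R → dg G y (nb G x .univ) ≤ ε * n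
  poor : ∀ s, s ∉ R → ee G (nb G s .univ) (nb G s .univ) ≤ ε ^ 2 * n ^ 2
  f2 : ∀ v w, F2.Adj v w → v ∉ R ∧ dg G v R < ε ^ 2 * n ∧ ∀ r ∈ R, ¬ H.Adj v r

namespace Cleaned
variable {G F H F2 : SimpleGraph V} {R : Finset V} {k : ℕ} {n ε : ℝ}

lemma npos (c : Cleaned G F H F2 R k n ε) : 0 < n := by
  have := c.hn
  have : (0:ℝ) ≤ k := Nat.cast_nonneg _
  linarith

lemma cardle (c : Cleaned G F H F2 R k n ε) (A : Finset V) : (A.card : ℝ) ≤ n := by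
  rw [← c.hV]; exact_mod_cast Finset.card_le_univ A

lemma kap {c : Cleaned G F H F2 R k n ε} {L : SimpleGraph V} (hL : L ≤ H) {W : Finset V}
    (hW : ∀ w ∈ W, w ∉ R) : ∀ a ∈ W, ∀ b ∈ W, L.Adj a b → dg L b (nb L a W) ≤ ε * n := by
  intro a ha b _ hab
  refine le_trans ?_ (c.cod a b (hL hab) (hW a ha))
  refine (dg_mono_graph (hL.trans c.hHG) _ _).trans (dg_mono _ _ ?_)
  intro x hx
  rw [mem_nb] at hx ⊢
  exact ⟨Finset.mem_univ _, c.hHG (hL hx.2)⟩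

/-- vertices of F2-edges -/
noncomputable def Q (F2 : SimpleGraph V) : Finset V := fs .univ (fun v => ∃ w, F2.Adj v w)

lemma memQ {F2 : SimpleGraph V} {v : V} : v ∈ Q F2 ↔ ∃ w, F2.Adj v w := by simp [Q]

lemma eeQ (F2 : SimpleGraph V) : ee F2 (Q F2) (Q F2) = ee F2 .univ .univ := by
  have h : ∀ v, dg F2 v (Q F2) = dg F2 v .univ := by
    intro v
    rw [← Finset.union_sdiff_of_subset (Finset.subset_univ (Q F2)), dg_union _ _ Finset.disjoint_sdiff,
      dg_zero (B := .univ \ Q F2), add_zero]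
    intro b hb hvb
    exact (Finset.mem_sdiff.1 hb).2 (memQ.2 ⟨v, hvb.symm⟩)
  conv_rhs => rw [← Finset.union_sdiff_of_subset (Finset.subset_univ (Q F2)),
    ee_union_left _ _ Finset.disjoint_sdiff]
  rw [ee_zero (A := .univ \ Q F2), add_zero, Finset.union_sdiff_of_subset (Finset.subset_univ (Q F2))]
  · unfold ee; exact Finset.sum_congr rfl fun v _ => h v
  · intro a ha b _ hab
    exact (Finset.mem_sdiff.1 ha).2 (memQ.2 ⟨b, hab⟩)

lemma QR (c : Cleaned G F H F2 R k n ε) : ∀ q ∈ Q F2, q ∉ R := by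
  intro q hq
  obtain ⟨w, hw⟩ := memQ.1 hq
  exact (c.f2 q w hw).1

lemma Qlarge (c : Cleaned G F H F2 R k n ε) : (1 / 3 - 45 * ε) * n ≤ (Q F2).card := by
  have h := mantel (H := F2) (W := Q F2) (κ := ε * n) (by have := c.npos; have := c.e0; positivity)
    (kap (c := c) c.hF2H c.QR)
  rw [eeQ] at h
  have := c.eF
  have := c.npos
  have e0 := c.e0
  have e1 := c.e1
  have h3 := c.cardle (Q F2)
  by_contra hcon
  push Not at hcon
  have h0 : (0:ℝ) ≤ (Q F2).card := Nat.cast_nonneg _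
  set f : ℝ := ((Q F2).card : ℝ)
  have h4 : f * f ≤ ((1 / 3 - 45 * ε) * n) * ((1 / 3 - 45 * ε) * n) :=
    mul_le_mul hcon.le hcon.le h0 (h0.trans hcon.le)
  have h5 : f * (ε * n) ≤ n * (ε * n) := by gcongr
  have h6 : ε * ε * (n * n) ≤ ε * (1 / 10 ^ 16) * (n * n) := by gcongr
  have h7 : 0 < ε * (n * n) := by positivity
  nlinarith

lemma Qmiss (c : Cleaned G F H F2 R k n ε) {s : V} (hs : s ∉ R) :
    n / 40 ≤ (Q F2 \ nb H s .univ).card := by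
  set N := nb H s .univ
  have h1 : Q F2 ⊆ N ∪ (Q F2 \ N) := by
    intro x hx; by_cases h : x ∈ N <;> simp [h, hx]
  have h2 := ee_mono F2 h1 h1
  have h3 := ee_union_left_le F2 N (Q F2 \ N) (N ∪ (Q F2 \ N))
  have h4 := ee_union_right_le F2 N (Q F2 \ N) N
  have h5 := ee_le_mul F2 (Q F2 \ N) (N ∪ (Q F2 \ N))
  have h6 := ee_le_mul F2 N (Q F2 \ N)
  have h7 : ee F2 N N ≤ ε ^ 2 * n ^ 2 := by
    refine le_trans ?_ (c.poor s hs)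
    have : N ⊆ nb G s .univ := by
      intro x hx
      rw [mem_nb] at hx ⊢
      exact ⟨hx.1, c.hHG hx.2⟩
    exact (ee_mono_graph (c.hF2H.trans c.hHG) _ _).trans (ee_mono _ this this)
  rw [eeQ] at h2
  have h8 := c.cardle N
  have h9 := c.cardle (N ∪ (Q F2 \ N))
  have h10 : (0:ℝ) ≤ (Q F2 \ N).card := Nat.cast_nonneg _
  have e0 := c.e0
  have e1 := c.e1
  have np := c.npos
  have := c.eF
  set t : ℝ := ((Q F2 \ N).card : ℝ)
  have h12 : ε ^ 2 * n ^ 2 ≤ ε * n ^ 2 := by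
    apply mul_le_mul_of_nonneg_right _ (by positivity); nlinarith
  have h11 : n ^ 2 / 18 - 8 * ε * n ^ 2 ≤ 2 * t * n := by nlinarith
  have h13 : ε * n ^ 2 ≤ 1 / 10 ^ 16 * n ^ 2 := by gcongr
  by_contra hcon
  push Not at hcon
  nlinarith


lemma split (c : Cleaned G F H F2 R k n ε) : ∃ (Y R1 : Finset V) (δ : ℝ), 0 ≤ δ ∧ Q F2 ⊆ Y ∧
    (∀ y ∈ Y, y ∉ R) ∧ R1 ⊆ R ∧ n = 2 * δ + Y.card + R1.card ∧ (R.card : ℝ) = δ + R1.card ∧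
    ee H .univ .univ ≤ ee H Y Y + ee H R1 R1
      + 2 * (δ * (Y.card + R1.card - n / 40 + ε * n)) + δ * (2 * δ + ε * n) := by
  obtain ⟨M, hM, hi1, hi2, hmax⟩ := exists_max_matching H ((Finset.univ \ R) \ Q F2) R
  set S1 := M.image Prod.fst with hS1
  set R' := M.image Prod.snd with hR'
  have hS1R : ∀ s ∈ S1, s ∉ R ∧ s ∉ Q F2 := by
    intro s hs
    obtain ⟨p, hp, rfl⟩ := Finset.mem_image.1 hs
    have := (hM p hp).1
    simpa using this
  have hR'R : R' ⊆ R := by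
    intro s hs
    obtain ⟨p, hp, rfl⟩ := Finset.mem_image.1 hs
    exact (hM p hp).2.1
  have cS1 : S1.card = M.card := Finset.card_image_of_injOn fun p hp q hq h => hi1 p hp q hq h
  have cR' : R'.card = M.card := Finset.card_image_of_injOn fun p hp q hq h => hi2 p hp q hq h
  set Y := (Finset.univ \ R) \ S1 with hY
  set R1 := R \ R' with hR1
  have memY : ∀ y, y ∈ Y ↔ y ∉ R ∧ y ∉ S1 := by intro y; simp [hY]
  have memR1 : ∀ y, y ∈ R1 ↔ y ∈ R ∧ y ∉ R' := by intro y; simp [hR1]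
  have hQY : Q F2 ⊆ Y := fun q hq => (memY q).2 ⟨c.QR q hq, fun h => (hS1R q h).2 hq⟩
  have hno : ∀ y ∈ Y, ∀ r ∈ R1, ¬ H.Adj y r := by
    intro y hy r hr hyr
    rw [memY] at hy
    rw [memR1] at hr
    by_cases hq : y ∈ Q F2
    · obtain ⟨w, hw⟩ := memQ.1 hq
      exact (c.f2 y w hw).2.2 r hr.1 hyr
    · exact hmax y (by simp [hq, hy.1]) r hr.1 hy.2 hr.2 hyr
  have dYR : Disjoint Y R1 := by
    rw [Finset.disjoint_left]; intro x hx hx'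
    exact ((memY x).1 hx).1 ((memR1 x).1 hx').1
  have dSR : Disjoint S1 R' := by
    rw [Finset.disjoint_left]; intro x hx hx'
    exact (hS1R x hx).1 (hR'R hx')
  have dAB : Disjoint (S1 ∪ R') (Y ∪ R1) := by
    rw [Finset.disjoint_left]; intro x hx hx'
    rw [Finset.mem_union] at hx hx'
    rw [memY, memR1] at hx'
    rcases hx with h | h
    · have := hS1R x h; tauto
    · have := hR'R h; tauto
  have hU : (Finset.univ : Finset V) = (S1 ∪ R') ∪ (Y ∪ R1) := by
    ext x
    simp only [Finset.mem_univ, Finset.mem_union, memY, memR1, true_iff]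
    tauto
  have cA : ((S1 ∪ R').card : ℝ) = 2 * M.card := by
    rw [Finset.card_union_of_disjoint dSR, cS1, cR']; push_cast; ring
  have cB : ((Y ∪ R1).card : ℝ) = Y.card + R1.card := by
    rw [Finset.card_union_of_disjoint dYR]; push_cast; ring
  have eA : ∀ X, ee H (S1 ∪ R') X = ∑ p ∈ M, (dg H p.1 X + dg H p.2 X) := by
    intro X
    rw [ee_union_left _ _ dSR, Finset.sum_add_distrib]
    unfold ee
    rw [hS1, hR', Finset.sum_image (fun p hp q hq h => hi1 p hp q hq h),
      Finset.sum_image (fun p hp q hq h => hi2 p hp q hq h)]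
  have bA : ee H (S1 ∪ R') (S1 ∪ R') ≤ M.card * (2 * M.card + ε * n) := by
    rw [eA, ← nsmul_eq_mul, ← Finset.sum_const]
    apply Finset.sum_le_sum; intro p hp
    have h := pair_bound c.hHG (s := p.1) (r := p.2) (κ := ε * n) (B := S1 ∪ R') (E := ∅)
      (c.cod p.1 p.2 (hM p hp).2.2 (hS1R p.1 (Finset.mem_image_of_mem _ hp)).1) (by simp) (by simp) (by simp)
    rw [cA] at h; simpa using h
  have bB : ee H (S1 ∪ R') (Y ∪ R1) ≤ M.card * (Y.card + R1.card - n / 40 + ε * n) := by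
    rw [eA, ← nsmul_eq_mul, ← Finset.sum_const]
    apply Finset.sum_le_sum; intro p hp
    have hpR := (hS1R p.1 (Finset.mem_image_of_mem _ hp)).1
    have h := pair_bound c.hHG (s := p.1) (r := p.2) (κ := ε * n) (B := Y ∪ R1)
      (E := Q F2 \ nb H p.1 .univ)
      (c.cod p.1 p.2 (hM p hp).2.2 hpR)
      ((Finset.sdiff_subset.trans hQY).trans Finset.subset_union_left)
      (fun x hx h => by simp at hx; exact hx.2 h)
      (fun x hx h => by
        obtain ⟨w, hw⟩ := memQ.1 (Finset.mem_sdiff.1 hx).1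
        exact (c.f2 x w hw).2.2 p.2 (hM p hp).2.1 h.symm)
    have h2 := c.Qmiss hpR
    rw [cB] at h
    linarith
  refine ⟨Y, R1, M.card, Nat.cast_nonneg _, hQY, fun y hy => ((memY y).1 hy).1, Finset.sdiff_subset, ?_, ?_, ?_⟩
  · rw [← c.hV, ← Finset.card_univ, hU, Finset.card_union_of_disjoint dAB]
    push_cast
    rw [cA, cB]; ring
  · have := card_sdiff_real hR'R
    rw [cR'] at this
    linarith
  · have e1 : ee H .univ .univ = ee H (S1 ∪ R') (S1 ∪ R') + ee H (S1 ∪ R') (Y ∪ R1)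
        + (ee H (Y ∪ R1) (S1 ∪ R') + ee H (Y ∪ R1) (Y ∪ R1)) := by
      rw [hU, ee_union_left _ _ dAB, ee_union_right _ _ dAB, ee_union_right _ _ dAB]
    have e2 : ee H (Y ∪ R1) (Y ∪ R1) = ee H Y Y + ee H R1 R1 := by
      rw [ee_union_left _ _ dYR, ee_union_right _ _ dYR, ee_union_right _ _ dYR,
        ee_comm H R1 Y, ee_zero hno]; ring
    rw [ee_comm H (Y ∪ R1) (S1 ∪ R')] at e1
    linarith

end Cleaned
end step2


section step3
variable {V : Type*} [DecidableEq V] [Fintype V]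

lemma star_arith {n ε y ρ δ eH eY eR : ℝ} (hn : 0 < n) (he : 0 < ε) (hδ : 0 ≤ δ) (hy : 0 ≤ y)
    (hρ : 0 ≤ ρ) (hs : n = 2 * δ + y + ρ) (h1 : n ^ 2 / 2 - 4 * ε * n ^ 2 ≤ eH)
    (h2 : eH ≤ eY + eR + 2 * (δ * (y + ρ - n / 40 + ε * n)) + δ * (2 * δ + ε * n))
    (h3 : 2 * eY ≤ y * (y + ε * n)) (h4 : eR ≤ ρ * ρ) :
    δ * n / 20 - 6 * (ε * n ^ 2) ≤ ρ * (ρ - 2 * y) / 2 := by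
  have h5 : ε * n * (y / 2 + 3 * δ) ≤ ε * n * (2 * n) := by
    apply mul_le_mul_of_nonneg_left _ (by positivity)
    linarith
  have h6 : n ^ 2 = (2 * δ + y + ρ) ^ 2 := by rw [hs]
  nlinarith

namespace Cleaned
variable {G F H F2 : SimpleGraph V} {R : Finset V} {k : ℕ} {n ε : ℝ}

lemma caseI (c : Cleaned G F H F2 R k n ε) (hG1 : n ^ 2 / 2 < ee G .univ .univ)
    (hG2 : ee G .univ .univ ≤ n ^ 2 / 2 + 2) (hR : (R.card : ℝ) ≤ 45 / 1000000 * n) : False := by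
  have np := c.npos
  have e0 := c.e0
  have e1 := c.e1
  have hk0 : (0:ℝ) ≤ k := Nat.cast_nonneg _
  set W := Finset.univ \ R with hW
  have hU : (Finset.univ : Finset V) = W ∪ R := by
    rw [hW, Finset.sdiff_union_of_subset (Finset.subset_univ _)]
  have h1 : ee H .univ .univ ≤ ee H W W + 2 * (n * R.card) := by
    have a1 := ee_union_left_le H W R .univ
    have a2 := ee_union_right_le H W R W
    have a3 := ee_le_mul H R .univ
    have a4 := ee_le_mul H W R
    rw [← hU] at a1 a2
    rw [Finset.card_univ, c.hV] at a3
    have a5 := c.cardle W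
    have a6 : (0:ℝ) ≤ R.card := Nat.cast_nonneg _
    nlinarith
  have h2 := c.eH
  have hen : ε * n ^ 2 ≤ 1 / 10 ^ 16 * n ^ 2 := by gcongr
  have hn2 : 0 < n ^ 2 := by positivity
  have h3 : n ^ 2 / 2 - 9001 / 100000000 * n ^ 2 ≤ ee H W W := by nlinarith
  have hpos : 0 < ee H W W := by nlinarith
  obtain ⟨X, hX, Y, hY, hd, hXY⟩ := near_bip (kap (c := c) (le_refl H) (W := W) (by intro w hw; simpa [hW] using hw))
    (by positivity) hpos
  have h4 := c.cardle W
  have h40 : (0:ℝ) ≤ W.card := Nat.cast_nonneg _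
  have h5 : (W.card : ℝ) ^ 2 ≤ n ^ 2 := pow_le_pow_left₀ h40 h4 2
  have h6 : (W.card : ℝ) * (ε * n) ≤ n * (ε * n) := mul_le_mul_of_nonneg_right h4 (by positivity)
  have h7 := ee_mono_graph c.hHG X Y
  have h8 := c.eF
  have h9 := ee_mono_graph c.hF2F .univ .univ
  refine bip_case (n := n) c.hk c.hV ?_ c.hFG c.hF hG1 hG2 ?_ hd ?_
  · have := c.hn; linarith
  · nlinarith
  · nlinarith

lemma caseII_arith {n ε y ρ δ f : ℝ} (hn : 0 < n) (he : 0 < ε) (e1 : ε ≤ 1 / 10 ^ 16) (hδ : 0 ≤ δ)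
    (hs : n = 2 * δ + y + ρ) (hf : (1 / 3 - 45 * ε) * n ≤ f) (hfy : f ≤ y)
    (hstar : δ * n / 20 - 6 * (ε * n ^ 2) ≤ ρ * (ρ - 2 * y) / 2) (hρ : 4 / 100000 * n ≤ ρ) :
    (2 / 3 - 1 / 10 ^ 10) * n ≤ ρ ∧ y ≤ (1 / 3 + 1 / 10 ^ 10) * n ∧
    ρ ≤ (2 / 3 + 1 / 10 ^ 14) * n ∧ 2 * δ ≤ (1 / 10 ^ 10 + 1 / 10 ^ 14) * n := by
  have hen : ε * n ≤ 1 / 10 ^ 16 * n := by gcongr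
  have h1 : -(3 / 10 ^ 11) * n ≤ ρ - 2 * y := by
    by_contra hcon
    push Not at hcon
    have h2 : 12 * (ε * n ^ 2) ≤ 12 / 10 ^ 16 * n ^ 2 := by nlinarith
    have h3 : 0 ≤ δ * n := by positivity
    have h4 : 4 / 100000 * n * (3 / 10 ^ 11 * n) ≤ ρ * (2 * y - ρ) := by
      apply mul_le_mul hρ (by linarith) (by positivity) (by nlinarith)
    have h5 : 4 / 100000 * n * (3 / 10 ^ 11 * n) < ρ * (2 * y - ρ) := by
      have : ρ * (3 / 10 ^ 11 * n) < ρ * (2 * y - ρ) := by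
        apply mul_lt_mul_of_pos_left (by linarith) (by nlinarith)
      nlinarith
    nlinarith
  refine ⟨?_, ?_, ?_, ?_⟩ <;> linarith


lemma trim {L : SimpleGraph V} {X Y : Finset V} {σ s : ℝ}
    (h : (X.card : ℝ) * Y.card - s ≤ ee L X Y) :
    ∃ X0 ⊆ X, ((X.card : ℝ) - X0.card) * σ ≤ s ∧ ∀ x ∈ X0, (Y.card : ℝ) - σ ≤ dg L x Y := by
  have h1 := few_low (c := (Y.card : ℝ) - σ) (d := σ) h (by linarith)
  refine ⟨X \ fs X (fun x => dg L x Y < (Y.card : ℝ) - σ), Finset.sdiff_subset, ?_, ?_⟩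
  · rw [card_sdiff_real (fs_sub _ _)]
    linarith
  · intro x hx
    rw [Finset.mem_sdiff, mem_fs] at hx
    by_contra hcon
    push Not at hcon
    exact hx.2 ⟨hx.1, hcon⟩

lemma bal_arith {n a b : ℝ} (hn : 0 < n) (hb : 0 ≤ b) (hs : a + b ≤ (1 / 3 + 1 / 10 ^ 10) * n)
    (hp : n ^ 2 / 36 - 1 / 10 ^ 10 * n ^ 2 ≤ a * b) (ha : 0 ≤ a) :
    (1 / 6 - 2 / 10 ^ 5) * n ≤ a ∧ a ≤ (1 / 6 + 2 / 10 ^ 5) * n := by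
  have key : ∀ t : ℝ, a = n / 6 + t → a * b ≤ n ^ 2 / 36 + n ^ 2 / (6 * 10 ^ 10) + t * n / 10 ^ 10 - t ^ 2 := by
    intro t ht
    have : a * b ≤ a * (n / 6 + n / 10 ^ 10 - t) := mul_le_mul_of_nonneg_left (by linarith) ha
    rw [ht] at this ⊢
    nlinarith
  have h := key (a - n / 6) (by ring)
  set t := a - n / 6 with ht
  have h2 : t ^ 2 ≤ t * n / 10 ^ 10 + 2 / 10 ^ 10 * n ^ 2 := by nlinarith
  constructor
  · by_contra hcon
    push Not at hcon
    have : t < - (2 / 10 ^ 5 * n) := by rw [ht]; linarith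
    nlinarith
  · by_contra hcon
    push Not at hcon
    have : 2 / 10 ^ 5 * n < t := by rw [ht]; linarith
    nlinarith

lemma div_ar {n z τ : ℝ} (hn : 0 < n) (h : z * (1 / 10 ^ 5 * n) ≤ τ / 10 ^ 10 * n ^ 2) :
    z ≤ τ / 10 ^ 5 * n := by
  have h2 : z * (1 / 10 ^ 5 * n) ≤ (τ / 10 ^ 5 * n) * (1 / 10 ^ 5 * n) := by
    refine h.trans (le_of_eq ?_); ring
  exact le_of_mul_le_mul_right h2 (by positivity)

set_option maxHeartbeats 2000000 in
lemma caseII (c : Cleaned G F H F2 R k n ε) {Y R1 : Finset V} {δ : ℝ} (hδ : 0 ≤ δ)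
    (hQY : Q F2 ⊆ Y) (hY : ∀ y ∈ Y, y ∉ R) (hR1 : R1 ⊆ R) (hs : n = 2 * δ + Y.card + R1.card)
    (hc : ee H .univ .univ ≤ ee H Y Y + ee H R1 R1
      + 2 * (δ * (Y.card + R1.card - n / 40 + ε * n)) + δ * (2 * δ + ε * n))
    (hstar : δ * n / 20 - 6 * (ε * n ^ 2) ≤ R1.card * (R1.card - 2 * Y.card) / 2)
    (hρ : 4 / 100000 * n ≤ R1.card) : ∃ T0 A0 C0, Conf G F k n T0 A0 C0 := by
  have np := c.npos
  have e0 := c.e0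
  have e1 := c.e1
  have hQc : ((Q F2).card : ℝ) ≤ Y.card := by exact_mod_cast Finset.card_le_card hQY
  have hfl := c.Qlarge
  obtain ⟨r1, r2, r3, r4⟩ := caseII_arith np e0 e1 hδ hs hfl hQc hstar hρ
  have hm := mantel (by positivity) (kap (c := c) (le_refl H) hY)
  have hm2 := near_bip (kap (c := c) c.hF2H c.QR) (by positivity)
    (by rw [eeQ]; have := c.eF; nlinarith [pow_pos np 2, mul_le_mul_of_nonneg_right e1 (pow_pos np 2).le])
  rw [eeQ] at hm2
  obtain ⟨A', hA', C', hC', dAC, hE⟩ := hm2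
  have hn2 : 0 < n ^ 2 := by positivity
  have hen : ε * n ^ 2 ≤ 1 / 10 ^ 16 * n ^ 2 := mul_le_mul_of_nonneg_right e1 hn2.le
  have hY0 : (0:ℝ) ≤ Y.card := Nat.cast_nonneg _
  have hQ0 : (0:ℝ) ≤ (Q F2).card := Nat.cast_nonneg _
  have hRd : (R1.card : ℝ) * R1.card - 4 / 10 ^ 10 * n ^ 2 ≤ ee H R1 R1 := by
    have a1 := c.eH
    have a2 : (Y.card : ℝ) * Y.card ≤ ((1 / 3 + 1 / 10 ^ 10) * n) * ((1 / 3 + 1 / 10 ^ 10) * n) :=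
      mul_le_mul r2 r2 hY0 (by positivity)
    have a3 : (Y.card : ℝ) * (ε * n) ≤ n * (ε * n) :=
      mul_le_mul_of_nonneg_right (c.cardle _) (by positivity)
    have a4 : δ * (Y.card + R1.card - n / 40 + ε * n) ≤ δ * (n + ε * n) :=
      mul_le_mul_of_nonneg_left (by linarith) hδ
    have a5 : δ * (2 * δ + ε * n) ≤ δ * (n + ε * n) := by
      apply mul_le_mul_of_nonneg_left _ hδ
      have : (0:ℝ) ≤ R1.card := Nat.cast_nonneg _
      linarith
    have a6 : δ * (n + ε * n) ≤ ((1 / 10 ^ 10 + 1 / 10 ^ 14) / 2 * n) * (n + ε * n) :=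
      mul_le_mul_of_nonneg_right (by linarith) (by positivity)
    have a7 : (R1.card : ℝ) * R1.card ≤ ((2 / 3 + 1 / 10 ^ 14) * n) * ((2 / 3 + 1 / 10 ^ 14) * n) :=
      mul_le_mul r3 r3 (Nat.cast_nonneg _) (by positivity)
    nlinarith
  have hf2 : ((Q F2).card : ℝ) ^ 2 ≤ ((1 / 3 + 1 / 10 ^ 10) * n) ^ 2 :=
    pow_le_pow_left₀ hQ0 (hQc.trans r2) 2
  have hf3 : ((Q F2).card : ℝ) * (ε * n) ≤ n * (ε * n) :=
    mul_le_mul_of_nonneg_right (c.cardle _) (by positivity)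
  have hE2 : n ^ 2 / 36 - 1 / 10 ^ 10 * n ^ 2 ≤ ee F2 A' C' := by
    have := c.eF
    nlinarith
  have hE3 := hE2.trans (ee_mono_graph c.hF2F A' C')
  have hsum : (A'.card : ℝ) + C'.card ≤ (1 / 3 + 1 / 10 ^ 10) * n := by
    have : A'.card + C'.card ≤ (Q F2).card := by
      rw [← Finset.card_union_of_disjoint dAC]
      exact Finset.card_le_card (Finset.union_subset hA' hC')
    have h2 : (A'.card : ℝ) + C'.card ≤ (Q F2).card := by exact_mod_cast this
    linarith
  have hprod := hE3.trans (ee_le_mul F A' C')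
  have hA0 : (0:ℝ) ≤ A'.card := Nat.cast_nonneg _
  have hC0 : (0:ℝ) ≤ C'.card := Nat.cast_nonneg _
  obtain ⟨bA1, bA2⟩ := bal_arith np hC0 hsum hprod hA0
  obtain ⟨bC1, bC2⟩ := bal_arith np hA0 (by linarith) (by rw [mul_comm (C'.card : ℝ)]; exact hprod) hC0
  have hp2 : (A'.card : ℝ) * C'.card ≤ n ^ 2 / 36 + 1 / 10 ^ 10 * n ^ 2 := by
    nlinarith [sq_nonneg ((A'.card : ℝ) - C'.card),
      mul_le_mul hsum hsum (by positivity) (by positivity)]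
  obtain ⟨A0, hA0s, hAc, hAd⟩ := trim (L := F) (X := A') (Y := C') (σ := 1 / 10 ^ 5 * n)
    (s := 2 / 10 ^ 10 * n ^ 2) (by linarith)
  obtain ⟨C0, hC0s, hCc, hCd⟩ := trim (L := F) (X := C') (Y := A') (σ := 1 / 10 ^ 5 * n)
    (s := 2 / 10 ^ 10 * n ^ 2) (by rw [ee_comm]; linarith)
  obtain ⟨T0, hT0s, hTc, hTd⟩ := trim (L := H) (X := R1) (Y := R1) (σ := 1 / 10 ^ 5 * n)
    (s := 4 / 10 ^ 10 * n ^ 2) hRd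
  have kA : (A'.card : ℝ) - A0.card ≤ 2 / 10 ^ 5 * n := div_ar np hAc
  have kC : (C'.card : ℝ) - C0.card ≤ 2 / 10 ^ 5 * n := div_ar np hCc
  have kT : (R1.card : ℝ) - T0.card ≤ 4 / 10 ^ 5 * n := div_ar np hTc
  have dge : ∀ {L : SimpleGraph V} {B B0 : Finset V} (v : V), B0 ⊆ B →
      dg L v B - (B.card - B0.card) ≤ dg L v B0 := by
    intro L B B0 v hB
    have h1 := dg_sdiff L v hB
    have h2 := dg_le_card L v (B \ B0)
    rw [card_sdiff_real hB] at h2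
    linarith
  have hT : ∀ v ∈ Q F2, dg G v T0 < 0.003 * n := by
    intro v hv
    obtain ⟨w, hw⟩ := memQ.1 hv
    have h1 := (c.f2 v w hw).2.1
    have h2 := dg_mono G v (hT0s.trans hR1)
    have h3 : ε ^ 2 * n ≤ 1 / 10 ^ 16 * n := by
      apply mul_le_mul_of_nonneg_right _ np.le; nlinarith
    linarith
  have dTQ : Disjoint T0 (Q F2) := by
    rw [Finset.disjoint_left]; intro x hx hq
    exact c.QR x hq (hR1 (hT0s hx))
  have l1 : (A0.card : ℝ) ≤ A'.card := by exact_mod_cast Finset.card_le_card hA0s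
  have l2 : (C0.card : ℝ) ≤ C'.card := by exact_mod_cast Finset.card_le_card hC0s
  have l3 : (T0.card : ℝ) ≤ R1.card := by exact_mod_cast Finset.card_le_card hT0s
  refine ⟨T0, A0, C0, ⟨c.hk, c.hV, c.hn, c.hFG, c.hF, ?_, ?_, ?_, ?_, ?_, ?_, ?_, ?_, ?_, ?_, ?_, ?_⟩⟩
  · exact dTQ.mono_right (hA0s.trans hA')
  · exact dTQ.mono_right (hC0s.trans hC')
  · exact Finset.disjoint_of_subset_left hA0s (Finset.disjoint_of_subset_right hC0s dAC)
  · linarith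
  · intro v hv
    have h1 := hTd v hv
    have h2 := dge (L := H) v hT0s
    have h3 := dg_mono_graph c.hHG v T0
    linarith
  · linarith
  · linarith
  · intro v hv
    have h1 := hAd v hv
    have h2 := dge (L := F) v hC0s
    linarith
  · intro v hv
    have h1 := hCd v hv
    have h2 := dge (L := F) v hA0s
    linarith
  · exact fun v hv => hT v (hA' (hA0s hv))
  · exact fun v hv => hT v (hC' (hC0s hv))
  · linarith

lemma final (c : Cleaned G F H F2 R k n ε) {N m : ℕ} (hN : Fintype.card V = N)
    (hm : m = (N + 1) / 3) (hG1 : n ^ 2 / 2 < ee G .univ .univ)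
    (hG2 : ee G .univ .univ ≤ n ^ 2 / 2 + 2) (hG : n ^ 2 + 3 ≤ 2 * ee G .univ .univ)
    (hFm : (m : ℝ) ^ 2 < 2 * ee F .univ .univ) : False := by
  have np := c.npos
  have e0 := c.e0
  have e1 := c.e1
  obtain ⟨Y, R1, δ, hδ, hQY, hY, hR1, hs, hRc, hc⟩ := c.split
  have hm1 := mantel (by positivity) (kap (c := c) (le_refl H) hY)
  have hY0 : (0:ℝ) ≤ Y.card := Nat.cast_nonneg _
  have hR0 : (0:ℝ) ≤ R1.card := Nat.cast_nonneg _
  have hstar := star_arith np e0 hδ hY0 hR0 hs c.eH hc hm1 (ee_le_mul H R1 R1)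
  have hn2 : 0 < n ^ 2 := by positivity
  have hen : ε * n ^ 2 ≤ 1 / 10 ^ 16 * n ^ 2 := mul_le_mul_of_nonneg_right e1 hn2.le
  rcases le_total (R1.card : ℝ) (4 / 100000 * n) with h | h
  · refine c.caseI hG1 hG2 ?_
    have h1 : (R1.card : ℝ) * R1.card ≤ (4 / 100000 * n) * (4 / 100000 * n) :=
      mul_le_mul h h hR0 (by positivity)
    have h2 : 0 ≤ (R1.card : ℝ) * Y.card := by positivity
    have h3 : δ ≤ 1 / 10 ^ 6 * n := by
      by_contra hcon
      push Not at hcon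
      nlinarith
    linarith
  · obtain ⟨T0, A0, C0, hconf⟩ := c.caseII hδ hQY hY hR1 hs hc hstar h
    have := hconf.final hN hm hG
    linarith

end Cleaned
end step3

section main

lemma ee_edges {N : ℕ} (G : SimpleGraph (Fin N)) :
    ee G .univ .univ = 2 * (G.edgeSet.ncard : ℝ) := by
  classical
  have h1 := G.sum_degrees_eq_twice_card_edges
  have h2 : G.edgeSet.ncard = G.edgeFinset.card := by
    rw [← SimpleGraph.coe_edgeFinset, Set.ncard_coe_finset]
  have h3 : ∀ v, dg G v .univ = (G.degree v : ℝ) := by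
    intro v
    rw [dg_eq_card, ← SimpleGraph.card_neighborFinset_eq_degree]
    congr 2
    ext x; simp
  rw [h2]
  unfold ee
  simp_rw [h3]
  exact_mod_cast h1

lemma cycle_of_PS {V : Type*} {G : SimpleGraph V} {k : ℕ} (hk : 3 ≤ k) {u v : V} {S : Finset V}
    (huv : G.Adj u v) (h : PS G (2 * k) u v S) : occursInC G (2 * k + 1) s(u, v) := by
  obtain ⟨p, hp, hl, -⟩ := h.symm
  refine ⟨u, Walk.cons huv p, ?_, by simp [hl], by simp⟩
  rw [Walk.cons_isCycle_iff]
  refine ⟨hp, fun he => ?_⟩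
  have := hp.length_eq_one_of_mem_edges (Sym2.eq_swap ▸ he)
  omega

lemma nat_arith (N : ℕ) : ((N + 1) / 3) ^ 2 < 4 * ((N + 4) / 6 * ((N + 1) / 6) + 1) := by
  obtain ⟨q, r, hr, rfl⟩ : ∃ q r, r < 6 ∧ N = 6 * q + r := ⟨N / 6, N % 6, Nat.mod_lt _ (by norm_num), by omega⟩
  have h : ∀ a b c : ℕ, (6 * q + r + 1) / 3 = a → (6 * q + r + 4) / 6 = b → (6 * q + r + 1) / 6 = c →
      a ^ 2 < 4 * (b * c + 1) → ((6 * q + r + 1) / 3) ^ 2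
        < 4 * ((6 * q + r + 4) / 6 * ((6 * q + r + 1) / 6) + 1) := by
    rintro a b c rfl rfl rfl h; exact h
  interval_cases r
  · exact h (2 * q) q q (by omega) (by omega) (by omega) (by nlinarith)
  · exact h (2 * q) q q (by omega) (by omega) (by omega) (by nlinarith)
  · exact h (2 * q + 1) (q + 1) q (by omega) (by omega) (by omega) (by nlinarith)
  · exact h (2 * q + 1) (q + 1) q (by omega) (by omega) (by omega) (by nlinarith)
  · exact h (2 * q + 1) (q + 1) q (by omega) (by omega) (by omega) (by nlinarith)
  · exact h (2 * q + 2) (q + 1) (q + 1) (by omega) (by omega) (by omega) (by nlinarith)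

lemma main_bound {k N : ℕ} (hk : 3 ≤ k) (hN : 10 ^ 96 * (16 * k + 173) ≤ N) (G F : SimpleGraph (Fin N))
    (hFG : F ≤ G) (hF : ∀ u v S, F.Adj u v → PS G (2 * k) u v S → False)
    (hG : G.edgeSet.ncard = N ^ 2 / 4 + 1) :
    F.edgeSet.ncard ≤ (N + 4) / 6 * ((N + 1) / 6) := by
  by_contra hcon
  push Not at hcon
  set n : ℝ := (N : ℝ) with hn
  have hNr : (10:ℝ) ^ 96 * (16 * k + 173) ≤ n := by
    have := (Nat.cast_le (α := ℝ)).2 hN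
    rw [Nat.cast_mul, Nat.cast_pow] at this
    push_cast at this
    norm_num at this ⊢
    exact this
  have hk0 : (0:ℝ) ≤ k := Nat.cast_nonneg _
  have hbig : (10:ℝ) ^ 90 * (16 * k + 173) ≤ n := by
    refine le_trans ?_ hNr
    apply mul_le_mul_of_nonneg_right _ (by positivity)
    norm_num
  have hn20 : (10:ℝ) ^ 20 ≤ n := by
    refine le_trans ?_ hbig
    nlinarith
  have np : 0 < n := by positivity
  have eG := ee_edges G
  have eF := ee_edges F
  have hG4 : N ^ 2 ≤ 4 * (N ^ 2 / 4) + 1 ∧ 4 * (N ^ 2 / 4) ≤ N ^ 2 := by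
    refine ⟨?_, by omega⟩
    rcases Nat.even_or_odd' N with ⟨j, h | h⟩
    · have : N ^ 2 = 4 * j ^ 2 := by rw [h]; ring
      omega
    · have : N ^ 2 = 4 * (j ^ 2 + j) + 1 := by rw [h]; ring
      omega
  set g := N ^ 2 / 4
  have g1 : n ^ 2 ≤ 4 * (g : ℝ) + 1 := by rw [hn]; exact_mod_cast hG4.1
  have g2 : 4 * (g : ℝ) ≤ n ^ 2 := by rw [hn]; exact_mod_cast hG4.2
  rw [hG] at eG
  push_cast at eG
  have hFm : (((N + 1) / 3 : ℕ) : ℝ) ^ 2 < 2 * ee F .univ .univ := by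
    have h1 := nat_arith N
    have h2 : ((N + 1) / 3) ^ 2 < 4 * F.edgeSet.ncard := by omega
    have h3 : (((N + 1) / 3 : ℕ) : ℝ) ^ 2 < 4 * (F.edgeSet.ncard : ℝ) := by exact_mod_cast h2
    linarith
  have hm3 : (n - 1) / 3 ≤ (((N + 1) / 3 : ℕ) : ℝ) := by
    have : N ≤ 3 * ((N + 1) / 3) + 1 := by omega
    have h2 : (N : ℝ) ≤ 3 * (((N + 1) / 3 : ℕ) : ℝ) + 1 := by exact_mod_cast this
    linarith
  have hF18 : n ^ 2 / 18 - 1 / 10 ^ 16 * n ^ 2 ≤ ee F .univ .univ := by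
    have h1 : ((n - 1) / 3) ^ 2 ≤ (((N + 1) / 3 : ℕ) : ℝ) ^ 2 :=
      pow_le_pow_left₀ (by linarith) hm3 2
    nlinarith
  have hV : (Fintype.card (Fin N) : ℝ) = n := by simp [hn]
  obtain ⟨H, F2, R, hHG, hF2H, hF2F, hH, hF2, hcod, hpoor, hf2⟩ :=
    cleaning (ε := 1 / 10 ^ 16) hk hFG hV hF (by positivity) (by norm_num) (by
      have : ((1:ℝ) / 10 ^ 16) ^ 6 * (10 ^ 96 * (16 * k + 173)) = 16 * k + 173 := by
        rw [← mul_assoc]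
        norm_num
      rw [← this]
      apply mul_le_mul_of_nonneg_left hNr (by positivity))
  have c : Cleaned G F H F2 R k n (1 / 10 ^ 16) :=
    ⟨hk, hV, by linarith, hFG, hF, hHG, hF2H, hF2F, by positivity, le_refl _, by linarith, by linarith,
      hcod, hpoor, hf2⟩
  exact c.final (by simp) rfl (by linarith) (by linarith) (by linarith) hFm

end main

theorem stmt2 :
    ∀ k : ℕ, 3 ≤ k → ∃ n₀ : ℕ, ∀ n : ℕ, n₀ ≤ n → ∀ G : SimpleGraph (Fin n),
      G.edgeSet.ncard = n ^ 2 / 4 + 1 →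
      n ^ 2 / 4 + 1 - (n + 4) / 6 * ((n + 1) / 6)
        ≤ countEdgesInC G (2 * k + 1) := by
  intro k hk
  refine ⟨10 ^ 96 * (16 * k + 173), fun n hn G hG => ?_⟩
  let F : SimpleGraph (Fin n) :=
    { Adj := fun u v => G.Adj u v ∧ ¬ ∃ S, PS G (2 * k) u v S
      symm := ⟨fun u v h => ⟨h.1.symm, fun ⟨S, hS⟩ => h.2 ⟨S, hS.symm⟩⟩⟩
      loopless := ⟨fun u h => h.1.ne rfl⟩ }
  have hF := main_bound hk hn G F (fun u v h => h.1) (fun u v S h hS => h.2 ⟨S, hS⟩) hG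
  have hsub : G.edgeSet ⊆ {e | e ∈ G.edgeSet ∧ occursInC G (2 * k + 1) e} ∪ F.edgeSet := by
    intro e he
    induction e with
    | _ u v =>
      by_cases h : ∃ S, PS G (2 * k) u v S
      · obtain ⟨S, hS⟩ := h
        exact Or.inl ⟨he, cycle_of_PS hk he hS⟩
      · exact Or.inr ⟨he, h⟩
  have h1 := (Set.ncard_le_ncard hsub (Set.toFinite _)).trans (Set.ncard_union_le _ _)
  unfold countEdgesInC
  rw [hG] at h1
  omega
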